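/- arXiv:2604.13700 — 6 statements merged into one kernel-verified Lean document; each statement's English description precedes it below -/
import Mathlib

section
/- Let r be a positive integer. Every r-regular digraph D satisfies c(D) ≥ ⌈(3/22)·r⌉. -/
/-- A digraph: a finite vertex set together with a set of arcs (no loops). -/
structure FinDigraph (V : Type) [DecidableEq V] where
  verts : Finset V
  arcs : Finset (V × V)
  mem_of_arc : ∀ a ∈ arcs, a.1 ∈ verts ∧ a.2 ∈ verts
  ne_of_arc : ∀ a ∈ arcs, a.1 ≠ a.2

namespace FinDigraph

variable {V : Type} [DecidableEq V]

/-- A directed cycle, represented as the list of its (distinct) vertices: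
at least two vertices, consecutive vertices form arcs, and there is an arc
from the last vertex back to the first. -/
def IsCycle (D : FinDigraph V) (C : List V) : Prop :=
  C.Nodup ∧ 2 ≤ C.length ∧ C.Chain' (fun a b => (a, b) ∈ D.arcs) ∧
    ∀ h : C ≠ [], (C.getLast h, C.head h) ∈ D.arcs

/-- `D` contains a collection of `k` openly disjoint directed cycles through a vertex. -/
def HasOpenCycles (D : FinDigraph V) (k : ℕ) : Prop :=
  ∃ (v : V) (C : Fin k → List V), v ∈ D.verts ∧
    (∀ i, D.IsCycle (C i) ∧ v ∈ C i) ∧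
    ∀ i j, i ≠ j → Disjoint ((C i).toFinset \ {v}) ((C j).toFinset \ {v})

/-- `c(D)`: the largest `k` such that `D` contains `k` openly disjoint cycles through
a vertex. -/
noncomputable def cNum (D : FinDigraph V) : ℕ := sSup {k | D.HasOpenCycles k}

/-- The out-degree of a vertex. -/
def outDeg (D : FinDigraph V) (v : V) : ℕ := (D.arcs.filter fun a => a.1 = v).card

/-- The in-degree of a vertex. -/
def inDeg (D : FinDigraph V) (v : V) : ℕ := (D.arcs.filter fun a => a.2 = v).card

/-- A digraph is `r`-regular if it is nonempty and every vertex has out- and in-degree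
exactly `r`. -/
def IsRegular (D : FinDigraph V) (r : ℕ) : Prop :=
  D.verts.Nonempty ∧ ∀ v ∈ D.verts, D.outDeg v = r ∧ D.inDeg v = r

end FinDigraph

namespace FinDigraph

variable {V : Type} [DecidableEq V] {D : FinDigraph V}

/-- The arcs with both ends in `U`. -/
def inner (D : FinDigraph V) (U : Finset V) : Finset (V × V) :=
  D.arcs.filter fun a => a.1 ∈ U ∧ a.2 ∈ U

/-- The out-neighbours of `w` that lie in `U`. -/
def outIn (D : FinDigraph V) (U : Finset V) (w : V) : Finset V := U.filter fun x => (w, x) ∈ D.arcs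

/-- The in-neighbours of `w` that lie in `U`. -/
def inIn (D : FinDigraph V) (U : Finset V) (w : V) : Finset V := U.filter fun x => (x, w) ∈ D.arcs

/-- No cycle through `w` avoids `S`; this is witnessed by a set `A` containing the vertices
that can be reached from `w` without meeting `S`. -/
structure IsSeparator (D : FinDigraph V) (w : V) (A S : Finset V) : Prop where
  notMem_left : w ∉ A
  notMem_right : w ∉ S
  disjoint : Disjoint A S
  subset_left : A ⊆ D.verts
  mem_of_arc : ∀ a ∈ D.arcs, a.1 ∈ insert w A → a.2 ∈ A ∨ a.2 ∈ S

/-! ### Menger's theorem for cycles through a vertex, by way of Hall's theorem -/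

/-- The vertices other than `w`, together with `k` copies of `w`. -/
abbrev Split (D : FinDigraph V) (w : V) (k : ℕ) : Type := {x // x ∈ D.verts.erase w} ⊕ Fin k

/-- The vertex of the digraph underlying a vertex of the split digraph. -/
def Split.base {w : V} {k : ℕ} : D.Split w k → V
  | .inl x => x
  | .inr _ => w

section Split

variable {w : V} {k : ℕ} {f : D.Split w k → D.Split w k}

/-- The least positive number of steps that leads from the `i`-th copy of `w` to a copy of `w`. -/
lemma exists_return_time (hf : f.Injective) (i : Fin k) :
    ∃ m, 0 < m ∧ (∃ j, f^[m] (.inr i) = .inr j) ∧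
      ∀ l, 0 < l → l < m → ∀ j, f^[l] (.inr i) ≠ .inr j := by
  classical
  have h : ∃ m, 0 < m ∧ ∃ j, f^[m] (.inr i) = .inr j := by
    obtain ⟨m, hm, h⟩ := hf.mem_periodicPts (.inr i)
    exact ⟨m, hm, i, h⟩
  refine ⟨Nat.find h, (Nat.find_spec h).1, (Nat.find_spec h).2, fun l hl hlm j hj => ?_⟩
  exact Nat.find_min h hlm ⟨hl, j, hj⟩

lemma hasOpenCycles_of_injective (hw : w ∈ D.verts) (hf : f.Injective)
    (harc : ∀ x, (∃ y, x = .inl y ∧ f x = x) ∨ (x.base, (f x).base) ∈ D.arcs) :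
    D.HasOpenCycles k := by
  choose m hpos hret hmin using fun i => exists_return_time hf i
  have hstep : ∀ i l, l < m i → (((f^[l] (.inr i)).base, (f^[l + 1] (.inr i)).base) ∈ D.arcs) := by
    intro i l hl
    rw [Function.iterate_succ_apply']
    rcases harc (f^[l] (.inr i)) with ⟨y, hy, h⟩ | h
    · have h' : f^[l] (f (.inr i)) = f^[l] (.inr i) := by
        rw [← Function.iterate_succ_apply, Function.iterate_succ_apply', h]
      have h1 := hf.iterate l h'
      rcases harc (.inr i) with ⟨z, hz, -⟩ | h2
      · cases hz
      · rw [h1] at h2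
        exact absurd rfl (D.ne_of_arc _ h2)
    · exact h
  have hinl : ∀ i l, 0 < l → l < m i → (f^[l] (.inr i)).base ≠ w := by
    intro i l h0 hl
    rcases hx : f^[l] (.inr i) with y | j
    · exact (Finset.mem_erase.1 y.2).1
    · exact absurd hx (hmin i l h0 hl j)
  have hbase : ∀ x y : D.Split w k, x.base ≠ w → x.base = y.base → x = y := by
    rintro (x | x) (y | y) hx hxy
    · exact congrArg _ (Subtype.ext hxy)
    · exact absurd hxy hx
    · exact absurd rfl hx
    · exact absurd rfl hx
  have hcancel : ∀ i j a b, 0 < a → a ≤ b → b < m j →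
      f^[a] (.inr i) = f^[b] (.inr j) → i = j ∧ a = b := by
    intro i j a b ha hab hb h
    obtain ⟨c, rfl⟩ := Nat.exists_eq_add_of_le hab
    rw [Function.iterate_add_apply] at h
    have h' := hf.iterate a h
    rcases Nat.eq_zero_or_pos c with rfl | hc
    · exact ⟨Sum.inr_injective h', rfl⟩
    · exact absurd h'.symm (hmin j c hc (by omega) i)
  have hcancel' : ∀ i j a b, 0 < a → a < m i → 0 < b → b < m j →
      (f^[a] (.inr i)).base = (f^[b] (.inr j)).base → i = j ∧ a = b := by
    intro i j a b ha ham hb hbm h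
    have h := hbase _ _ (hinl i a ha ham) h
    rcases le_total a b with hab | hab
    · exact hcancel i j a b ha hab hbm h
    · obtain ⟨h1, h2⟩ := hcancel j i b a hb hab ham h.symm
      exact ⟨h1.symm, h2.symm⟩
  have htwo : ∀ i, 2 ≤ m i := by
    intro i
    by_contra hlt
    have h1 : m i = 1 := by have := hpos i; omega
    obtain ⟨j, hj⟩ := hret i
    have h2 := hstep i 0 (hpos i)
    rw [← h1, Nat.zero_add, hj] at h2
    exact D.ne_of_arc _ h2 rfl
  refine ⟨w, fun i => (List.range (m i)).map fun l => (f^[l] (.inr i)).base, hw, ?_, ?_⟩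
  · refine fun i => ⟨⟨?_, by simpa using htwo i, ?_, ?_⟩, ?_⟩
    · refine List.Nodup.map_on ?_ List.nodup_range
      intro a ha b hb h
      rw [List.mem_range] at ha hb
      rcases Nat.eq_zero_or_pos a with rfl | ha0 <;> rcases Nat.eq_zero_or_pos b with rfl | hb0
      · rfl
      · exact absurd h.symm (hinl i b hb0 hb)
      · exact absurd h (hinl i a ha0 ha)
      · exact (hcancel' i i a b ha0 ha hb0 hb h).2
    · refine List.isChain_iff_getElem.2 fun l hl => ?_
      simp only [List.length_map, List.length_range] at hl
      simpa using hstep i l (by omega)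
    · intro h
      obtain ⟨j, hj⟩ := hret i
      have h2 := hstep i (m i - 1) (by have := hpos i; omega)
      rw [Nat.sub_add_cancel (hpos i), hj] at h2
      simpa [List.getLast_eq_getElem, List.head_eq_getElem, Split.base] using h2
    · exact List.mem_map.2 ⟨0, List.mem_range.2 (hpos i), rfl⟩
  · intro i j hij
    rw [Finset.disjoint_left]
    intro x hx hx'
    simp only [Finset.mem_sdiff, List.mem_toFinset, List.mem_map, List.mem_range,
      Finset.mem_singleton] at hx hx'
    obtain ⟨⟨a, ha, rfl⟩, hxw⟩ := hx
    obtain ⟨⟨b, hb, hab⟩, -⟩ := hx'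
    rcases Nat.eq_zero_or_pos a with rfl | ha0
    · exact hxw rfl
    rcases Nat.eq_zero_or_pos b with rfl | hb0
    · exact hxw hab.symm
    exact hij (hcancel' i j a b ha0 ha hb0 hb hab.symm).1

end Split

/-- Menger's theorem for openly disjoint cycles through a vertex. -/
theorem hasOpenCycles_or_exists_isSeparator {w : V} (hw : w ∈ D.verts) (k : ℕ) :
    D.HasOpenCycles k ∨ ∃ A S, D.IsSeparator w A S ∧ S.card < k := by
  classical
  let t : D.Split w k → Finset (D.Split w k) := fun x =>
    Finset.univ.filter fun y => (∃ z, x = .inl z ∧ y = x) ∨ (x.base, y.base) ∈ D.arcs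
  by_cases hall : ∀ s : Finset (D.Split w k), s.card ≤ (s.biUnion t).card
  · obtain ⟨f, hf, hft⟩ := (Finset.all_card_le_biUnion_card_iff_exists_injective t).1 hall
    exact .inl (hasOpenCycles_of_injective hw hf fun x => (Finset.mem_filter.1 (hft x)).2)
  right
  push Not at hall
  obtain ⟨Z, hZ⟩ := hall
  have hmem : ∀ x y, x ∈ Z → (x.base, y.base) ∈ D.arcs → y ∈ Z.biUnion t := fun x y hx hxy =>
    Finset.mem_biUnion.2 ⟨x, hx, Finset.mem_filter.2 ⟨Finset.mem_univ _, .inr hxy⟩⟩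
  have hZl : Z.toLeft ⊆ (Z.biUnion t).toLeft := by
    intro x hx
    rw [Finset.mem_toLeft] at hx ⊢
    exact Finset.mem_biUnion.2
      ⟨_, hx, Finset.mem_filter.2 ⟨Finset.mem_univ _, .inl ⟨x, rfl, rfl⟩⟩⟩
  have hcZ := Finset.card_toLeft_add_card_toRight (u := Z)
  have hcN := Finset.card_toLeft_add_card_toRight (u := Z.biUnion t)
  have hle := Finset.card_le_card hZl
  have hright : Z.toRight.card ≤ k := by simpa using Finset.card_le_univ Z.toRight
  obtain ⟨i, hi⟩ : Z.toRight.Nonempty := by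
    rw [← Finset.card_pos]; omega
  rw [Finset.mem_toRight] at hi
  have hnot : ∀ x ∈ Z, (x.base, w) ∉ D.arcs := by
    intro x hx h
    have huniv : (Z.biUnion t).toRight = Finset.univ := by
      ext j
      simpa using hmem x (.inr j) hx h
    rw [huniv, Finset.card_univ, Fintype.card_fin] at hcN
    omega
  let A : Finset V := Z.toLeft.map (Function.Embedding.subtype _)
  let N : Finset V := (Z.biUnion t).toLeft.map (Function.Embedding.subtype _)
  have hAN : A ⊆ N := Finset.map_subset_map.2 hZl
  have hNw : w ∉ N := by
    intro h
    obtain ⟨x, -, hx⟩ := Finset.mem_map.1 h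
    exact (Finset.mem_erase.1 x.2).1 hx
  refine ⟨A, N \ A, ⟨fun h => hNw (hAN h), fun h => hNw (Finset.mem_sdiff.1 h).1,
    Finset.disjoint_sdiff, ?_, ?_⟩, ?_⟩
  · intro x hx
    obtain ⟨y, -, rfl⟩ := Finset.mem_map.1 hx
    exact (Finset.mem_erase.1 y.2).2
  · rintro ⟨u, v⟩ ha hu
    obtain ⟨x, hx, hxu⟩ : ∃ x ∈ Z, x.base = u := by
      rcases Finset.mem_insert.1 hu with h | h
      · exact ⟨.inr i, hi, h.symm⟩
      · obtain ⟨y, hy, rfl⟩ := Finset.mem_map.1 h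
        exact ⟨.inl y, Finset.mem_toLeft.1 hy, rfl⟩
    subst hxu
    have hv : v ∈ D.verts.erase w := by
      refine Finset.mem_erase.2 ⟨?_, (D.mem_of_arc _ ha).2⟩
      rintro rfl
      exact hnot x hx ha
    have : v ∈ N := Finset.mem_map.2
      ⟨⟨v, hv⟩, Finset.mem_toLeft.2 (hmem x (.inl ⟨v, hv⟩) hx ha), rfl⟩
    by_cases hvA : v ∈ A
    · exact .inl hvA
    · exact .inr (Finset.mem_sdiff.2 ⟨this, hvA⟩)
  · have h1 := Finset.card_sdiff_add_card_eq_card hAN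
    have h2 : A.card = Z.toLeft.card := Finset.card_map _
    have h3 : N.card = (Z.biUnion t).toLeft.card := Finset.card_map _
    omega

/-! ### Counting arcs -/

lemma IsRegular.card_filter_fst {r : ℕ} (h : D.IsRegular r) {X : Finset V} (hX : X ⊆ D.verts) :
    (D.arcs.filter fun a => a.1 ∈ X).card = r * X.card := by
  rw [Finset.card_eq_sum_card_fiberwise (t := X) (f := Prod.fst) (by intro a; simp),
    Finset.sum_congr rfl (g := fun _ => r), Finset.sum_const, smul_eq_mul, mul_comm]
  intro x hx
  rw [← (h.2 x (hX hx)).1, outDeg, Finset.filter_filter]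
  congr 1
  ext a
  simp only [Finset.mem_filter]
  constructor
  · rintro ⟨h1, -, h2⟩; exact ⟨h1, h2⟩
  · rintro ⟨h1, rfl⟩; exact ⟨h1, hx, rfl⟩

lemma IsRegular.card_filter_snd {r : ℕ} (h : D.IsRegular r) {X : Finset V} (hX : X ⊆ D.verts) :
    (D.arcs.filter fun a => a.2 ∈ X).card = r * X.card := by
  rw [Finset.card_eq_sum_card_fiberwise (t := X) (f := Prod.snd) (by intro a; simp),
    Finset.sum_congr rfl (g := fun _ => r), Finset.sum_const, smul_eq_mul, mul_comm]
  intro x hx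
  rw [← (h.2 x (hX hx)).2, inDeg, Finset.filter_filter]
  congr 1
  ext a
  simp only [Finset.mem_filter]
  constructor
  · rintro ⟨h1, -, h2⟩; exact ⟨h1, h2⟩
  · rintro ⟨h1, rfl⟩; exact ⟨h1, hx, rfl⟩

lemma card_inner_eq_sum_outIn (U : Finset V) :
    (D.inner U).card = ∑ w ∈ U, (D.outIn U w).card := by
  rw [Finset.card_eq_sum_card_fiberwise (t := U) (f := Prod.fst)
    (by intro a ha; exact (Finset.mem_filter.1 ha).2.1)]
  refine Finset.sum_congr rfl fun w hw => ?_
  refine Finset.card_nbij' Prod.snd (fun x => (w, x)) ?_ ?_ ?_ ?_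
  · rintro ⟨x, y⟩ h
    obtain ⟨⟨h1, -, h2⟩, rfl⟩ : ((x, y) ∈ D.arcs ∧ x ∈ U ∧ y ∈ U) ∧ x = w := by
      simpa [inner] using h
    exact Finset.mem_coe.2 (Finset.mem_filter.2 ⟨h2, h1⟩)
  · intro x h; simp_all [inner, outIn]
  · rintro ⟨x, y⟩ h; simp_all [inner]
  · intro x h; rfl

lemma card_inner_eq_sum_inIn (U : Finset V) :
    (D.inner U).card = ∑ w ∈ U, (D.inIn U w).card := by
  rw [Finset.card_eq_sum_card_fiberwise (t := U) (f := Prod.snd)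
    (by intro a ha; exact (Finset.mem_filter.1 ha).2.2)]
  refine Finset.sum_congr rfl fun w hw => ?_
  refine Finset.card_nbij' Prod.fst (fun x => (x, w)) ?_ ?_ ?_ ?_
  · rintro ⟨x, y⟩ h
    obtain ⟨⟨h1, h2, -⟩, rfl⟩ : ((x, y) ∈ D.arcs ∧ x ∈ U ∧ y ∈ U) ∧ y = w := by
      simpa [inner] using h
    exact Finset.mem_coe.2 (Finset.mem_filter.2 ⟨h2, h1⟩)
  · intro x h; simp_all [inner, inIn]
  · rintro ⟨x, y⟩ h; simp_all [inner]
  · intro x h; rfl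

lemma IsRegular.card_outIn_le {r : ℕ} (h : D.IsRegular r) (U : Finset V) {w : V}
    (hw : w ∈ D.verts) : (D.outIn U w).card ≤ r := by
  rw [← (h.2 w hw).1, outDeg]
  refine Finset.card_le_card_of_injOn (fun x => (w, x)) ?_ ?_
  · intro x hx; simp_all [outIn]
  · intro x _ y _ hxy; exact (Prod.mk.inj hxy).2

lemma IsRegular.card_inIn_le {r : ℕ} (h : D.IsRegular r) (U : Finset V) {w : V}
    (hw : w ∈ D.verts) : (D.inIn U w).card ≤ r := by
  rw [← (h.2 w hw).2, inDeg]
  refine Finset.card_le_card_of_injOn (fun x => (x, w)) ?_ ?_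
  · intro x hx; simp_all [inIn]
  · intro x _ y _ hxy; exact (Prod.mk.inj hxy).1

lemma card_inter_add_card_sdiff_le (U A S : Finset V) (w : V) :
    (U ∩ insert w (A ∪ S)).card + (U \ A).card ≤ U.card + S.card + 1 := by
  rw [← Finset.card_union_add_card_inter, add_assoc]
  refine add_le_add (Finset.card_le_card ?_) ?_
  · exact Finset.union_subset Finset.inter_subset_left Finset.sdiff_subset
  · refine (Finset.card_le_card (t := insert w S) ?_).trans (Finset.card_insert_le _ _)
    intro x hx
    simp only [Finset.mem_inter, Finset.mem_insert, Finset.mem_union, Finset.mem_sdiff] at hx ⊢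
    tauto

namespace IsSeparator

variable {w : V} {A S : Finset V}

lemma outIn_subset (h : D.IsSeparator w A S) (U : Finset V) : D.outIn U w ⊆ A ∪ S := by
  intro x hx
  exact Finset.mem_union.2 (h.mem_of_arc _ (Finset.mem_filter.1 hx).2 (Finset.mem_insert_self _ _))

lemma notMem_of_mem_inIn (h : D.IsSeparator w A S) {U : Finset V} {x : V} (hx : x ∈ D.inIn U w) :
    x ∉ A := by
  intro hxA
  rcases h.mem_of_arc _ (Finset.mem_filter.1 hx).2 (Finset.mem_insert_of_mem hxA) with h' | h'
  · exact h.notMem_left h'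
  · exact h.notMem_right h'

/-- The neighbours joined to `w` by arcs in both directions lie in every separator. -/
lemma card_outIn_add_card_inIn_le (h : D.IsSeparator w A S) (U : Finset V) :
    (D.outIn U w).card + (D.inIn U w).card ≤ U.card + S.card := by
  rw [← Finset.card_union_add_card_inter]
  refine add_le_add (Finset.card_le_card ?_) (Finset.card_le_card ?_)
  · exact Finset.union_subset (Finset.filter_subset _ _) (Finset.filter_subset _ _)
  · intro x hx
    obtain ⟨h1, h2⟩ := Finset.mem_inter.1 hx
    exact (Finset.mem_union.1 (h.outIn_subset U h1)).resolve_left (h.notMem_of_mem_inIn h2)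

/-- Few arcs lead back from the far side of a separator to its near side. -/
lemma card_back_arcs_add_le {r : ℕ} (hreg : D.IsRegular r) (hw : w ∈ D.verts)
    (h : D.IsSeparator w A S) (hS : S ⊆ D.verts) :
    (D.arcs.filter fun a => a.1 ∉ insert w (A ∪ S) ∧ a.2 ∈ A).card + r ≤ r * S.card := by
  have h1 := hreg.card_filter_snd h.subset_left
  have h2 := hreg.card_filter_snd hS
  have h3 := hreg.card_filter_fst (Finset.insert_subset hw h.subset_left)
  rw [Finset.card_insert_of_notMem h.notMem_left] at h3
  have h4 : (D.arcs.filter fun a => a.1 ∈ insert w A).card ≤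
      (D.arcs.filter fun a => a.1 ∈ insert w A ∧ a.2 ∈ A).card +
        (D.arcs.filter fun a => a.2 ∈ S).card := by
    refine (Finset.card_le_card ?_).trans (Finset.card_union_le _ _)
    intro a ha
    obtain ⟨ha, ha1⟩ := Finset.mem_filter.1 ha
    rw [Finset.mem_union, Finset.mem_filter, Finset.mem_filter]
    exact (h.mem_of_arc a ha ha1).imp (fun h' => ⟨ha, ha1, h'⟩) fun h' => ⟨ha, h'⟩
  have h5 : (D.arcs.filter fun a => a.1 ∉ insert w (A ∪ S) ∧ a.2 ∈ A).card +
      (D.arcs.filter fun a => a.1 ∈ insert w A ∧ a.2 ∈ A).card ≤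
        (D.arcs.filter fun a => a.2 ∈ A).card := by
    rw [← Finset.card_union_of_disjoint]
    · refine Finset.card_le_card (Finset.union_subset ?_ ?_) <;>
      · intro a ha
        rw [Finset.mem_filter] at ha ⊢
        exact ⟨ha.1, ha.2.2⟩
    · rw [Finset.disjoint_left]
      intro a ha ha'
      simp only [Finset.mem_filter, Finset.mem_insert, Finset.mem_union] at ha ha'
      tauto
  rw [h1] at h5
  rw [h2, h3] at h4
  linarith [mul_add r A.card 1]

/-- A separator splits a vertex set `U` into two overlapping parts; few arcs are lost. -/
lemma card_inner_le {r : ℕ} (hreg : D.IsRegular r) (hw : w ∈ D.verts)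
    (h : D.IsSeparator w A S) (hS : S ⊆ D.verts) (U : Finset V) :
    (D.inner U).card + r ≤ (D.inner (U ∩ insert w (A ∪ S))).card + (D.inner (U \ A)).card +
      r * S.card := by
  have h1 := h.card_back_arcs_add_le hreg hw hS
  have h2 : (D.inner U).card ≤ (D.inner (U ∩ insert w (A ∪ S)) ∪ D.inner (U \ A) ∪
      D.arcs.filter fun a => a.1 ∉ insert w (A ∪ S) ∧ a.2 ∈ A).card := by
    refine Finset.card_le_card fun a ha => ?_
    obtain ⟨ha, ha1, ha2⟩ := Finset.mem_filter.1 ha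
    have h3 := h.mem_of_arc a ha
    have h4 : a.2 ∈ A → a.2 ∉ S := fun h' => Finset.disjoint_left.1 h.disjoint h'
    simp only [inner, Finset.mem_union, Finset.mem_filter, Finset.mem_inter, Finset.mem_sdiff,
      Finset.mem_insert] at h3 ⊢
    tauto
  have h3 := Finset.card_union_le (D.inner (U ∩ insert w (A ∪ S)) ∪ D.inner (U \ A))
    (D.arcs.filter fun a => a.1 ∉ insert w (A ∪ S) ∧ a.2 ∈ A)
  have h4 := Finset.card_union_le (D.inner (U ∩ insert w (A ∪ S))) (D.inner (U \ A))
  omega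

end IsSeparator

/-- If every vertex of an `r`-regular digraph has a separator of size at most `s`, then
`r ≤ 6 * s`. -/
theorem IsRegular.le_six_mul {r s : ℕ} (hreg : D.IsRegular r)
    (hsep : ∀ w ∈ D.verts, ∃ A S, D.IsSeparator w A S ∧ S ⊆ D.verts ∧ S.card ≤ s) :
    r ≤ 6 * s := by
  classical
  by_contra! hlt
  let good : Finset V → Prop := fun U =>
    U ⊆ D.verts ∧ r ≤ 2 * U.card ∧ r * U.card ≤ (D.inner U).card + 2 * (r * s)
  have hgood : good D.verts := by
    refine ⟨subset_rfl, ?_, ?_⟩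
    · obtain ⟨w, hw⟩ := hreg.1
      have h1 : D.outIn D.verts w = (D.arcs.filter fun a => a.1 = w).image Prod.snd := by
        ext x
        simp only [outIn, Finset.mem_filter, Finset.mem_image, Prod.exists]
        constructor
        · rintro ⟨-, h⟩; exact ⟨w, x, ⟨h, rfl⟩, rfl⟩
        · rintro ⟨a, b, ⟨h, rfl⟩, rfl⟩; exact ⟨(D.mem_of_arc _ h).2, h⟩
      have h2 : (D.outIn D.verts w).card = r := by
        rw [h1, Finset.card_image_of_injOn, ← (hreg.2 w hw).1, outDeg]
        rintro ⟨a, b⟩ ha ⟨c, d⟩ hc rfl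
        simp_all
      have h3 : (D.outIn D.verts w).card ≤ D.verts.card :=
        Finset.card_le_card (Finset.filter_subset _ _)
      omega
    · rw [← hreg.card_filter_fst subset_rfl]
      refine le_add_right (Finset.card_le_card fun a ha => ?_)
      obtain ⟨ha, ha1⟩ := Finset.mem_filter.1 ha
      exact Finset.mem_filter.2 ⟨ha, ha1, (D.mem_of_arc _ ha).2⟩
  obtain ⟨U, ⟨hUV, hUr, hUe⟩, hmin⟩ :=
    exists_minimal_of_wellFoundedLT good ⟨_, hgood⟩
  have hlow : ∀ w ∈ U, 2 * ((D.outIn U w).card + (D.inIn U w).card) ≤ 3 * r := by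
    intro w hw
    have hwV := hUV hw
    have hout := hreg.card_outIn_le U hwV
    have hin := hreg.card_inIn_le U hwV
    by_contra! hcon
    obtain ⟨A, S, h, hSV, hS⟩ := hsep w hwV
    have hle := h.card_inner_le hreg hwV hSV U
    have hcard := card_inter_add_card_sdiff_le U A S w
    have hsub1 : D.outIn U w ⊆ U ∩ insert w (A ∪ S) := fun x hx => Finset.mem_inter.2
      ⟨(Finset.mem_filter.1 hx).1, Finset.mem_insert_of_mem (h.outIn_subset U hx)⟩
    have hsub2 : D.inIn U w ⊆ U \ A := fun x hx => Finset.mem_sdiff.2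
      ⟨(Finset.mem_filter.1 hx).1, h.notMem_of_mem_inIn hx⟩
    have hc1 := Finset.card_le_card hsub1
    have hc2 := Finset.card_le_card hsub2
    have hbig : ∀ U' : Finset V, U' ⊆ U → r ≤ 2 * U'.card → ¬ U ⊆ U' →
        (D.inner U').card + 2 * (r * s) < r * U'.card := by
      intro U' hU' hr' hne
      by_contra! hcon'
      exact hne (hmin ⟨hU'.trans hUV, hr', hcon'⟩ hU')
    have h1 := hbig (U ∩ insert w (A ∪ S)) Finset.inter_subset_left (by omega) (by
      intro hsub
      have : D.inIn U w ⊆ S := by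
        intro x hx
        have hx1 := (Finset.mem_inter.1 (hsub (Finset.mem_filter.1 hx).1)).2
        have hx2 := h.notMem_of_mem_inIn hx
        have hx3 : x ≠ w := D.ne_of_arc _ (Finset.mem_filter.1 hx).2
        simp only [Finset.mem_insert, Finset.mem_union] at hx1
        tauto
      have := Finset.card_le_card this
      omega)
    have h2 := hbig (U \ A) Finset.sdiff_subset (by omega) (by
      intro hsub
      have : D.outIn U w ⊆ S := by
        intro x hx
        exact (Finset.mem_union.1 (h.outIn_subset U hx)).resolve_left
          (Finset.mem_sdiff.1 (hsub (Finset.mem_filter.1 hx).1)).2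
      have := Finset.card_le_card this
      omega)
    have h3 := Nat.mul_le_mul_left r hcard
    have h4 := Nat.mul_le_mul_left r hS
    simp only [mul_add, mul_one] at h3
    omega
  have hsum : ∑ w ∈ U, ((D.outIn U w).card + (D.inIn U w).card) = 2 * (D.inner U).card := by
    rw [Finset.sum_add_distrib, ← card_inner_eq_sum_outIn, ← card_inner_eq_sum_inIn, two_mul]
  have hb1 : 2 * (2 * (D.inner U).card) ≤ U.card * (3 * r) := by
    rw [← hsum, Finset.mul_sum, ← smul_eq_mul (a := U.card)]
    exact Finset.sum_le_card_nsmul _ _ _ hlow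
  have hb2 : 2 * (D.inner U).card ≤ U.card * (U.card + s) := by
    rw [← hsum, ← smul_eq_mul (a := U.card)]
    refine Finset.sum_le_card_nsmul _ _ _ fun w hw => ?_
    obtain ⟨A, S, h, -, hS⟩ := hsep w (hUV hw)
    have := h.card_outIn_add_card_inIn_le U
    omega
  have hr : 0 < r := by omega
  have hU8 : U.card ≤ 8 * s := by
    refine Nat.le_of_mul_le_mul_left ?_ hr
    nlinarith
  have hUpos : 0 < U.card := by omega
  zify at *
  nlinarith [mul_nonneg (sub_nonneg.2 hUr) (sub_nonneg.2 hU8), mul_pos hUpos (sub_pos.2 hlt)]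

/-! ### The maximum number of openly disjoint cycles -/

lemma IsCycle.mem_verts {C : List V} (hC : D.IsCycle C) {x : V} (hx : x ∈ C) : x ∈ D.verts := by
  obtain ⟨-, -, hchain, hlast⟩ := hC
  obtain ⟨i, hi, rfl⟩ := List.getElem_of_mem hx
  by_cases h : i + 1 < C.length
  · exact (D.mem_of_arc _ (List.isChain_iff_getElem.1 hchain i h)).1
  · have h' := (D.mem_of_arc _ (hlast (List.ne_nil_of_mem hx))).1
    rw [List.getLast_eq_getElem] at h'
    convert h' using 2
    omega

lemma bddAbove_hasOpenCycles (D : FinDigraph V) : BddAbove {k | D.HasOpenCycles k} := by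
  refine ⟨D.verts.card, ?_⟩
  rintro k ⟨v, C, -, hC, hdisj⟩
  have h : ∀ i, ∃ x ∈ C i, x ≠ v := by
    intro i
    obtain ⟨hnd, hlen, -⟩ := (hC i).1
    by_contra! hall
    have h0 := hall _ (List.getElem_mem (l := C i) (n := 0) (by omega))
    have h1 := hall _ (List.getElem_mem (l := C i) (n := 1) (by omega))
    have := (hnd.getElem_inj_iff (hi := by omega) (hj := by omega)).1 (h0.trans h1.symm)
    omega
  choose x hx hxv using h
  have hmem : ∀ i, x i ∈ (C i).toFinset \ {v} := fun i => by simp [hx, hxv]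
  have hinj : Set.InjOn x (Finset.univ : Finset (Fin k)) := by
    intro i _ j _ hij
    by_contra hne
    exact Finset.disjoint_left.1 (hdisj i j hne) (hmem i) (hij ▸ hmem j)
  simpa using Finset.card_le_card_of_injOn x
    (fun i _ => (hC i).1.mem_verts (hx i)) hinj

end FinDigraph

/-- Let `r` be a positive integer. Every `r`-regular digraph `D`
satisfies `c(D) ≥ ⌈(3/22)·r⌉`. -/
theorem regular_digraph_cNum_ge {V : Type} [DecidableEq V] (r : ℕ) (hr : 1 ≤ r)
    (D : FinDigraph V) (hreg : D.IsRegular r) :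
    ⌈(3 / 22 : ℚ) * r⌉₊ ≤ D.cNum := by
  set k := ⌈(3 / 22 : ℚ) * r⌉₊ with hk
  by_contra hlt
  have hkpos : 0 < k := Nat.ceil_pos.2 (by positivity)
  have hnot : ¬ D.HasOpenCycles k := fun h => hlt (le_csSup D.bddAbove_hasOpenCycles h)
  have hsix : r ≤ 6 * (k - 1) := by
    refine hreg.le_six_mul fun w hw => ?_
    obtain ⟨A, S, h, hS⟩ :=
      (FinDigraph.hasOpenCycles_or_exists_isSeparator hw k).resolve_left hnot
    refine ⟨A, S ∩ D.verts, ⟨h.notMem_left, fun h' => h.notMem_right (Finset.mem_inter.1 h').1,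
      h.disjoint.mono_right Finset.inter_subset_left, h.subset_left, fun a ha ha1 => ?_⟩,
      Finset.inter_subset_right, ?_⟩
    · exact (h.mem_of_arc a ha ha1).imp_right fun h' =>
        Finset.mem_inter.2 ⟨h', (D.mem_of_arc a ha).2⟩
    · have := Finset.card_le_card (Finset.inter_subset_left : S ∩ D.verts ⊆ S)
      omega
  have hceil := Nat.ceil_lt_add_one (show (0 : ℚ) ≤ 3 / 22 * r by positivity)
  rw [← hk] at hceil
  have hcast : (r : ℚ) ≤ 6 * (k - 1) := by
    have h : r + 6 ≤ 6 * k := by omega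
    have : (r : ℚ) + 6 ≤ 6 * k := by exact_mod_cast h
    linarith
  have : (1 : ℚ) ≤ r := by exact_mod_cast hr
  linarith
end

section
/- For all positive integers r and b, c_{rb} ≤ c_r · b. -/
/-- \`c_r\`: the minimum of \`c(D)\` over all \`r\`-regular digraphs \`D\`
(with vertices taken from \`ℕ\`, which loses no generality). -/
noncomputable def cMin (r : ℕ) : ℕ :=
  sInf {k | ∃ D : FinDigraph ℕ, D.IsRegular r ∧ D.cNum = k}

namespace FinDigraph

variable {V : Type} [DecidableEq V]

theorem IsCycle.arc_mod {D : FinDigraph V} {C : List V} (h : D.IsCycle C) (i : ℕ)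
    (hi : i < C.length) :
    (C[i], C[(i + 1) % C.length]'(Nat.mod_lt _ (by omega))) ∈ D.arcs := by
  obtain ⟨-, -, hchain, hlast⟩ := h
  by_cases h' : i + 1 < C.length
  · simpa only [Nat.mod_eq_of_lt h'] using List.isChain_iff_getElem.1 hchain i h'
  · obtain rfl : i = C.length - 1 := by omega
    have hne : C ≠ [] := by
      rintro rfl
      simp at hi
    have := hlast hne
    rw [List.getLast_eq_getElem, List.head_eq_getElem] at this
    have hmod : (C.length - 1 + 1) % C.length = 0 := by
      rw [Nat.sub_add_cancel (by omega), Nat.mod_self]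
    simpa only [hmod] using this

/-- `S` separates `v` from itself: walks starting at `v` stay inside `R` without returning to `v`
until they meet `S`. -/
def IsCut (D : FinDigraph V) (v : V) (R : Set V) (S : Finset V) : Prop :=
  v ∈ R ∧ v ∉ S ∧ ∀ x ∈ R, ∀ y, (x, y) ∈ D.arcs → y ∈ S ∨ (y ∈ R ∧ y ≠ v)

theorem IsCut.exists_mem {D : FinDigraph V} {v : V} {R : Set V} {S : Finset V}
    (h : D.IsCut v R S) {C : List V} (hC : D.IsCycle C) (hv : v ∈ C) : ∃ x ∈ C, x ∈ S := by
  by_contra! hS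
  obtain ⟨j, hj, hjv⟩ := List.getElem_of_mem hv
  have hpos : 0 < C.length := by omega
  have key : ∀ n : ℕ, C[(j + n) % C.length]'(Nat.mod_lt _ hpos) ∈ R ∧
      (0 < n → C[(j + n) % C.length]'(Nat.mod_lt _ hpos) ≠ v) := by
    intro n
    induction n with
    | zero =>
      simp only [Nat.add_zero, Nat.mod_eq_of_lt hj, hjv]
      exact ⟨h.1, fun h0 => absurd h0 (lt_irrefl _)⟩
    | succ n ih =>
      have harc := hC.arc_mod ((j + n) % C.length) (Nat.mod_lt _ hpos)
      simp only [Nat.mod_add_mod, Nat.add_assoc] at harc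
      rcases h.2.2 _ ih.1 _ harc with hs | hs
      · exact absurd hs (hS _ (List.getElem_mem _))
      · exact ⟨hs.1, fun _ => hs.2⟩
  refine (key C.length).2 hpos ?_
  simpa only [Nat.add_mod_right, Nat.mod_eq_of_lt hj] using hjv

/-- Openly disjoint cycles through `v` meet a cut at `v` in distinct vertices. -/
theorem IsCut.le_card {D : FinDigraph V} {v : V} {R : Set V} {S : Finset V}
    (h : D.IsCut v R S) {k : ℕ} {C : Fin k → List V} (hC : ∀ i, D.IsCycle (C i) ∧ v ∈ C i)
    (hdisj : ∀ i j, i ≠ j → Disjoint ((C i).toFinset \ {v}) ((C j).toFinset \ {v})) :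
    k ≤ S.card := by
  choose x hxC hxS using fun i => h.exists_mem (hC i).1 (hC i).2
  have hx : ∀ i, x i ∈ (C i).toFinset \ {v} := fun i => by
    simp only [Finset.mem_sdiff, List.mem_toFinset, Finset.mem_singleton]
    exact ⟨hxC i, fun e => h.2.1 (e ▸ hxS i)⟩
  have hinj : Function.Injective x := fun i j hij => by
    by_contra hne
    exact Finset.disjoint_left.1 (hdisj i j hne) (hx i) (hij ▸ hx j)
  simpa using Finset.card_le_card_of_injOn (s := Finset.univ) (t := S) x (fun i _ => hxS i)
    hinj.injOn

theorem HasOpenCycles.le_card_verts {D : FinDigraph V} {k : ℕ} (h : D.HasOpenCycles k) :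
    k ≤ D.verts.card := by
  obtain ⟨v, C, -, hC, hdisj⟩ := h
  have hcut : D.IsCut v {v} (D.verts.erase v) := by
    refine ⟨rfl, by simp, fun x hx y hy => Or.inl ?_⟩
    obtain rfl : x = v := hx
    exact Finset.mem_erase.2 ⟨(D.ne_of_arc _ hy).symm, (D.mem_of_arc _ hy).2⟩
  exact (hcut.le_card hC hdisj).trans (Finset.card_le_card (Finset.erase_subset _ _))

theorem hasOpenCycles_zero {D : FinDigraph V} (h : D.verts.Nonempty) : D.HasOpenCycles 0 := by
  obtain ⟨v, hv⟩ := h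
  exact ⟨v, Fin.elim0, hv, fun i => i.elim0, fun i => i.elim0⟩

theorem HasOpenCycles.le_cNum {D : FinDigraph V} {k : ℕ} (h : D.HasOpenCycles k) : k ≤ D.cNum :=
  le_csSup ⟨D.verts.card, fun _ hk => HasOpenCycles.le_card_verts hk⟩ h

section Menger

variable {D : FinDigraph V} {v : V} {k : ℕ}

/-- The vertex underlying an element of the disjoint union of `k` copies of `v` and the remaining
vertices. -/
def copyVertex (D : FinDigraph V) (v : V) (k : ℕ) : Fin k ⊕ D.verts.erase v → V :=
  Sum.elim (fun _ => v) (fun x => x)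

theorem copyVertex_eq_iff (y : Fin k ⊕ D.verts.erase v) :
    copyVertex D v k y = v ↔ y.isLeft := by
  rcases y with i | x
  · simp [copyVertex]
  · simpa [copyVertex] using (Finset.mem_erase.1 x.2).1

theorem copyVertex_inj {y z : Fin k ⊕ D.verts.erase v} (hy : ¬ y.isLeft)
    (h : copyVertex D v k y = copyVertex D v k z) : y = z := by
  have hz : ¬ z.isLeft := by rwa [← copyVertex_eq_iff, ← h, copyVertex_eq_iff]
  rcases y with i | x
  · simp at hy
  · rcases z with j | z
    · simp at hz
    · exact congrArg Sum.inr (Subtype.ext h)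

/-- An injective choice of successors on `k` copies of `v` and the remaining vertices, where only
the latter may be fixed, traces out `k` openly disjoint cycles through `v`. -/
theorem hasOpenCycles_of_injective_s1 (hv : v ∈ D.verts)
    (f : Fin k ⊕ D.verts.erase v → Fin k ⊕ D.verts.erase v) (hf : Function.Injective f)
    (hfix : ∀ i, f (Sum.inl i) ≠ Sum.inl i)
    (harc : ∀ y, f y ≠ y → (copyVertex D v k y, copyVertex D v k (f y)) ∈ D.arcs) :
    D.HasOpenCycles k := by
  classical
  have harc' : ∀ i n, (copyVertex D v k (f^[n] (Sum.inl i)),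
      copyVertex D v k (f^[n + 1] (Sum.inl i))) ∈ D.arcs := by
    intro i n
    rw [Function.iterate_succ_apply']
    refine harc _ fun h => hfix i ?_
    rw [← Function.iterate_succ_apply' f n, Function.iterate_succ_apply] at h
    exact hf.iterate n h
  have hret : ∀ i : Fin k, ∃ n, 0 < n ∧ (f^[n] (Sum.inl i)).isLeft := by
    intro i
    obtain ⟨n, hn, hp⟩ := Function.mem_periodicPts.1 (hf.mem_periodicPts (Sum.inl i))
    exact ⟨n, hn, by rw [hp.eq]; rfl⟩
  let n : Fin k → ℕ := fun i => Nat.find (hret i)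
  have hpos : ∀ i, 0 < n i := fun i => (Nat.find_spec (hret i)).1
  have hleft : ∀ i, (f^[n i] (Sum.inl i)).isLeft := fun i => (Nat.find_spec (hret i)).2
  have hmin : ∀ i m, 0 < m → m < n i → ¬ (f^[m] (Sum.inl i)).isLeft :=
    fun i m h0 hm h => Nat.find_min (hret i) hm ⟨h0, h⟩
  have hcol : ∀ i j a c, a ≤ c → c < n j → f^[a] (Sum.inl i) = f^[c] (Sum.inl j) →
      a = c ∧ i = j := by
    intro i j a c hac hc h
    obtain ⟨d, rfl⟩ := Nat.exists_eq_add_of_le hac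
    rw [Function.iterate_add_apply] at h
    have h' := hf.iterate a h
    rcases Nat.eq_zero_or_pos d with rfl | hd
    · exact ⟨rfl, Sum.inl_injective h'⟩
    · exact absurd (by rw [← h']; rfl) (hmin j d hd (by omega))
  have hcol' : ∀ i j a c, a < n i → c < n j → f^[a] (Sum.inl i) = f^[c] (Sum.inl j) →
      a = c ∧ i = j := by
    intro i j a c ha hc h
    rcases le_total a c with hac | hac
    · exact hcol i j a c hac hc h
    · exact (hcol j i c a hac ha h.symm).imp Eq.symm Eq.symm
  have hzero : ∀ i m, m < n i → copyVertex D v k (f^[m] (Sum.inl i)) = v → m = 0 := by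
    intro i m hm h
    by_contra h0
    exact hmin i m (by omega) hm ((copyVertex_eq_iff _).1 h)
  refine ⟨v, fun i => (List.range (n i)).map fun m => copyVertex D v k (f^[m] (Sum.inl i)), hv,
    fun i => ⟨⟨?_, ?_, ?_, ?_⟩, ?_⟩, ?_⟩
  · refine List.Nodup.map_on (fun a ha c hc h => ?_) List.nodup_range
    rw [List.mem_range] at ha hc
    by_cases hL : (f^[a] (Sum.inl i)).isLeft
    · have hav := (copyVertex_eq_iff _).2 hL
      rw [hzero i a ha hav, hzero i c hc (h ▸ hav)]
    · exact (hcol' i i a c ha hc (copyVertex_inj hL h)).1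
  · have h1 : n i ≠ 1 := fun h1 => by
      have hl := (copyVertex_eq_iff _).2 (hleft i)
      have := D.ne_of_arc _ (harc' i 0)
      rw [h1] at hl
      exact this hl.symm
    have := hpos i
    simp only [List.length_map, List.length_range]
    omega
  · refine List.isChain_iff_getElem.2 fun m hm => ?_
    simpa using harc' i m
  · intro h
    have hl := (copyVertex_eq_iff _).2 (hleft i)
    have := harc' i (n i - 1)
    rw [Nat.sub_add_cancel (hpos i), hl] at this
    rw [List.getLast_eq_getElem, List.head_eq_getElem]
    simpa [copyVertex] using this
  · exact List.mem_map.2 ⟨0, List.mem_range.2 (hpos i), rfl⟩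
  · intro i j hij
    rw [Finset.disjoint_left]
    intro x hx hx'
    simp only [Finset.mem_sdiff, List.mem_toFinset, List.mem_map, List.mem_range,
      Finset.mem_singleton] at hx hx'
    obtain ⟨⟨a, ha, hax⟩, hxv⟩ := hx
    obtain ⟨⟨c, hc, hcx⟩, -⟩ := hx'
    refine hij (hcol' i j a c ha hc (copyVertex_inj (fun hL => hxv ?_) (hax.trans hcx.symm))).2
    rw [← hax, copyVertex_eq_iff]
    exact hL

/-- Menger's theorem for openly disjoint cycles through a vertex. -/
theorem hasOpenCycles_of_forall_isCut (hv : v ∈ D.verts)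
    (h : ∀ R S, D.IsCut v R S → k ≤ S.card) : D.HasOpenCycles k := by
  classical
  let p := copyVertex D v k
  let t : Fin k ⊕ D.verts.erase v → Finset (Fin k ⊕ D.verts.erase v) := fun y =>
    Finset.univ.filter fun z => (z = y ∧ ¬ y.isLeft) ∨ (p y, p z) ∈ D.arcs
  have ht : ∀ y z, z ∈ t y ↔ (z = y ∧ ¬ y.isLeft) ∨ (p y, p z) ∈ D.arcs := by simp [t]
  suffices hall : ∀ X : Finset (Fin k ⊕ D.verts.erase v), X.card ≤ (X.biUnion t).card by
    obtain ⟨f, hf, hft⟩ := (Finset.all_card_le_biUnion_card_iff_exists_injective t).1 hall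
    refine hasOpenCycles_of_injective_s1 hv f hf (fun i hi => ?_) (fun y hy => ?_)
    · rcases (ht _ _).1 (hft (Sum.inl i)) with hc | hc
      · exact hc.2 rfl
      · exact D.ne_of_arc _ hc (congrArg p hi.symm)
    · exact ((ht _ _).1 (hft y)).resolve_left fun hc => hy hc.1
  intro X
  have hright : ∀ y ∈ X, ¬ y.isLeft → y ∈ X.biUnion t := fun y hy hl =>
    Finset.mem_biUnion.2 ⟨y, hy, (ht _ _).2 (Or.inl ⟨rfl, hl⟩)⟩
  by_cases hX : ∃ y ∈ X, y.isLeft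
  swap
  · push Not at hX
    exact Finset.card_le_card fun y hy => hright y hy (by simpa using hX y hy)
  by_cases hN : ∃ z ∈ X.biUnion t, z.isLeft
  · obtain ⟨z, hz, hzl⟩ := hN
    obtain ⟨y, hy, hyz⟩ := Finset.mem_biUnion.1 hz
    have hpz : p z = v := (copyVertex_eq_iff _).2 hzl
    have hyv : (p y, v) ∈ D.arcs := by
      rcases (ht _ _).1 hyz with hc | hc
      · exact absurd (hc.1 ▸ hzl) hc.2
      · rwa [hpz] at hc
    refine Finset.card_le_card fun w hw => ?_
    by_cases hwl : w.isLeft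
    · refine Finset.mem_biUnion.2 ⟨y, hy, (ht _ _).2 (Or.inr ?_)⟩
      rwa [show p w = v from (copyVertex_eq_iff _).2 hwl]
    · exact hright w hw hwl
  · push Not at hN
    obtain ⟨y₀, hy₀, hy₀l⟩ := hX
    have hp₀ : p y₀ = v := (copyVertex_eq_iff _).2 hy₀l
    have hcut : D.IsCut v (p '' X) ((X.biUnion t \ X).image p) := by
      refine ⟨⟨y₀, hy₀, hp₀⟩, fun hmem => ?_, ?_⟩
      · obtain ⟨z, hz, hzv⟩ := Finset.mem_image.1 hmem
        exact hN z (Finset.mem_sdiff.1 hz).1 ((copyVertex_eq_iff _).1 hzv)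
      · rintro _ ⟨y, hy, rfl⟩ w hw
        have hwv : w ≠ v := fun e => by
          refine hN y₀ (Finset.mem_biUnion.2 ⟨y, hy, (ht _ _).2 (Or.inr ?_)⟩) hy₀l
          rwa [hp₀, ← e]
        let z : Fin k ⊕ D.verts.erase v :=
          Sum.inr ⟨w, Finset.mem_erase.2 ⟨hwv, (D.mem_of_arc _ hw).2⟩⟩
        have hz : z ∈ X.biUnion t := Finset.mem_biUnion.2 ⟨y, hy, (ht _ _).2 (Or.inr hw)⟩
        by_cases hzX : z ∈ X
        · exact Or.inr ⟨⟨z, hzX, rfl⟩, hwv⟩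
        · exact Or.inl (Finset.mem_image.2 ⟨z, Finset.mem_sdiff.2 ⟨hz, hzX⟩, rfl⟩)
    have hk : k ≤ (X.biUnion t \ X).card := (h _ _ hcut).trans Finset.card_image_le
    have hleft : (X \ X.biUnion t).card ≤ k := by
      have hsub : X \ X.biUnion t ⊆ Finset.univ.image (Sum.inl : Fin k → _) := fun y hy => by
        rw [Finset.mem_sdiff] at hy
        rcases y with i | x
        · simp
        · exact absurd (hright _ hy.1 (by simp)) hy.2
      refine (Finset.card_le_card hsub).trans (Finset.card_image_le.trans ?_)
      simp
    exact Finset.card_sdiff_le_card_sdiff_iff.1 (hleft.trans hk)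

end Menger

theorem exists_isCut_card_le_cNum {D : FinDigraph V} {v : V} (hv : v ∈ D.verts) :
    ∃ R S, D.IsCut v R S ∧ S.card ≤ D.cNum := by
  by_contra! h
  have := (hasOpenCycles_of_forall_isCut (k := D.cNum + 1) hv h).le_cNum
  omega

theorem mul_add_div_of_lt {a b i : ℕ} (hi : i < b) : (a * b + i) / b = a := by
  rw [mul_comm, Nat.mul_add_div (by omega), Nat.div_eq_of_lt hi, add_zero]

theorem mem_image_mul_add {b : ℕ} (hb : 1 ≤ b) {S : Finset ℕ} {x : ℕ} :
    x ∈ (S ×ˢ Finset.range b).image (fun q => q.1 * b + q.2) ↔ x / b ∈ S := by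
  simp only [Finset.mem_image, Finset.mem_product, Finset.mem_range, Prod.exists]
  constructor
  · rintro ⟨a, i, ⟨ha, hi⟩, rfl⟩
    rwa [mul_add_div_of_lt hi]
  · exact fun h => ⟨x / b, x % b, ⟨h, Nat.mod_lt _ hb⟩, Nat.div_add_mod' x b⟩

/-- The digraph obtained by replacing every vertex `v` by the `b` independent vertices
`v * b, …, v * b + b - 1`. -/
def blowup (D : FinDigraph ℕ) (b : ℕ) : FinDigraph ℕ where
  verts := (D.verts ×ˢ Finset.range b).image fun q => q.1 * b + q.2
  arcs := (D.arcs ×ˢ (Finset.range b ×ˢ Finset.range b)).image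
    fun q => (q.1.1 * b + q.2.1, q.1.2 * b + q.2.2)
  mem_of_arc := by
    intro a ha
    obtain ⟨⟨e, i, j⟩, hq, rfl⟩ := Finset.mem_image.1 ha
    simp only [Finset.mem_product] at hq
    exact ⟨Finset.mem_image.2 ⟨(e.1, i), Finset.mem_product.2
        ⟨(D.mem_of_arc e hq.1).1, hq.2.1⟩, rfl⟩,
      Finset.mem_image.2 ⟨(e.2, j), Finset.mem_product.2
        ⟨(D.mem_of_arc e hq.1).2, hq.2.2⟩, rfl⟩⟩
  ne_of_arc := by
    intro a ha
    obtain ⟨⟨e, i, j⟩, hq, rfl⟩ := Finset.mem_image.1 ha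
    simp only [Finset.mem_product, Finset.mem_range] at hq
    intro heq
    refine D.ne_of_arc e hq.1 ?_
    have := congrArg (· / b) heq
    simpa [mul_add_div_of_lt hq.2.1, mul_add_div_of_lt hq.2.2] using this

section Blowup

variable {D : FinDigraph ℕ} {b : ℕ}

theorem mem_verts_blowup (hb : 1 ≤ b) {x : ℕ} : x ∈ (D.blowup b).verts ↔ x / b ∈ D.verts :=
  mem_image_mul_add hb

theorem mem_arcs_blowup (hb : 1 ≤ b) {x y : ℕ} :
    (x, y) ∈ (D.blowup b).arcs ↔ (x / b, y / b) ∈ D.arcs := by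
  simp only [blowup, Finset.mem_image, Finset.mem_product, Finset.mem_range, Prod.exists,
    Prod.mk.injEq]
  constructor
  · rintro ⟨u, w, i, j, ⟨h, hi, hj⟩, rfl, rfl⟩
    rwa [mul_add_div_of_lt hi, mul_add_div_of_lt hj]
  · exact fun h => ⟨x / b, y / b, x % b, y % b, ⟨h, Nat.mod_lt _ hb, Nat.mod_lt _ hb⟩,
      Nat.div_add_mod' x b, Nat.div_add_mod' y b⟩

theorem card_image_mul_add (S : Finset ℕ) :
    ((S ×ˢ Finset.range b).image fun q => q.1 * b + q.2).card = S.card * b := by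
  rw [Finset.card_image_of_injOn, Finset.card_product, Finset.card_range]
  rintro ⟨a, i⟩ h ⟨c, j⟩ h' heq
  simp only [Finset.coe_product, Set.mem_prod, Finset.mem_coe, Finset.mem_range] at h h' heq
  have hac : a = c := by rw [← mul_add_div_of_lt (a := a) h.2, heq, mul_add_div_of_lt h'.2]
  subst hac
  simpa using heq

theorem outDeg_eq_card (D : FinDigraph ℕ) (x : ℕ) :
    D.outDeg x = (D.verts.filter fun y => (x, y) ∈ D.arcs).card := by
  refine Finset.card_nbij' Prod.snd (fun y => (x, y)) ?_ ?_ ?_ ?_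
  · rintro ⟨u, w⟩ h
    simp only [Finset.coe_filter, Set.mem_ofPred_eq] at h ⊢
    obtain ⟨h, rfl⟩ := h
    exact ⟨(D.mem_of_arc _ h).2, h⟩
  · intro y h
    simp_all
  · rintro ⟨u, w⟩ h
    simp_all
  · intro y _
    rfl

theorem inDeg_eq_card (D : FinDigraph ℕ) (x : ℕ) :
    D.inDeg x = (D.verts.filter fun y => (y, x) ∈ D.arcs).card := by
  refine Finset.card_nbij' Prod.fst (fun y => (y, x)) ?_ ?_ ?_ ?_
  · rintro ⟨u, w⟩ h
    simp only [Finset.coe_filter, Set.mem_ofPred_eq] at h ⊢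
    obtain ⟨h, rfl⟩ := h
    exact ⟨(D.mem_of_arc _ h).1, h⟩
  · intro y h
    simp_all
  · rintro ⟨u, w⟩ h
    simp_all
  · intro y _
    rfl

theorem IsRegular.blowup {r : ℕ} (h : D.IsRegular r) (hb : 1 ≤ b) :
    (D.blowup b).IsRegular (r * b) := by
  obtain ⟨⟨v, hv⟩, hdeg⟩ := h
  refine ⟨⟨v * b, ?_⟩, fun x hx => ?_⟩
  · rwa [mem_verts_blowup hb, Nat.mul_div_cancel _ hb]
  · rw [mem_verts_blowup hb] at hx
    obtain ⟨hout, hin⟩ := hdeg _ hx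
    rw [← hout]
    constructor
    · rw [outDeg_eq_card, outDeg_eq_card, ← card_image_mul_add]
      congr 1
      ext y
      rw [mem_image_mul_add hb, Finset.mem_filter, Finset.mem_filter, mem_verts_blowup hb,
        mem_arcs_blowup hb]
    · rw [hout, ← hin, inDeg_eq_card, inDeg_eq_card, ← card_image_mul_add]
      congr 1
      ext y
      rw [mem_image_mul_add hb, Finset.mem_filter, Finset.mem_filter, mem_verts_blowup hb,
        mem_arcs_blowup hb]

theorem IsCut.blowup {v : ℕ} {R : Set ℕ} {S : Finset ℕ} (hb : 1 ≤ b)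
    (h : D.IsCut (v / b) R S) :
    (D.blowup b).IsCut v {x | x / b ∈ R}
      ((S ×ˢ Finset.range b).image fun q => q.1 * b + q.2) := by
  refine ⟨h.1, fun hv => h.2.1 ((mem_image_mul_add hb).1 hv), fun x hx y hxy => ?_⟩
  rcases h.2.2 _ hx _ ((mem_arcs_blowup hb).1 hxy) with hy | ⟨hy, hyv⟩
  · exact Or.inl ((mem_image_mul_add hb).2 hy)
  · exact Or.inr ⟨hy, fun e => hyv (e ▸ rfl)⟩

theorem cNum_blowup_le (hD : D.verts.Nonempty) (hb : 1 ≤ b) :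
    (D.blowup b).cNum ≤ D.cNum * b := by
  have hne : (D.blowup b).verts.Nonempty := by
    obtain ⟨v, hv⟩ := hD
    exact ⟨v * b, by rwa [mem_verts_blowup hb, Nat.mul_div_cancel _ hb]⟩
  refine csSup_le ⟨0, hasOpenCycles_zero hne⟩ ?_
  rintro k ⟨v, C, hv, hC, hdisj⟩
  obtain ⟨R, S, hcut, hS⟩ := exists_isCut_card_le_cNum ((mem_verts_blowup hb).1 hv)
  calc k ≤ _ := (hcut.blowup hb).le_card hC hdisj
    _ = S.card * b := card_image_mul_add S
    _ ≤ D.cNum * b := Nat.mul_le_mul_right b hS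

end Blowup

theorem exists_isRegular (r : ℕ) : ∃ D : FinDigraph ℕ, D.IsRegular r := by
  let D : FinDigraph ℕ :=
    { verts := Finset.range (r + 1)
      arcs := (Finset.range (r + 1)).offDiag
      mem_of_arc := fun a ha => ⟨(Finset.mem_offDiag.1 ha).1, (Finset.mem_offDiag.1 ha).2.1⟩
      ne_of_arc := fun a ha => (Finset.mem_offDiag.1 ha).2.2 }
  refine ⟨D, ⟨0, Finset.mem_range.2 r.succ_pos⟩, fun x hx => ?_⟩
  have hx' : x ∈ Finset.range (r + 1) := hx
  have hcard : ((Finset.range (r + 1)).erase x).card = r := by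
    rw [Finset.card_erase_of_mem hx', Finset.card_range, Nat.add_sub_cancel]
  constructor
  · rw [outDeg_eq_card]
    convert hcard using 2
    ext y
    simp only [D, Finset.mem_filter, Finset.mem_offDiag, Finset.mem_erase]
    tauto
  · rw [inDeg_eq_card]
    convert hcard using 2
    ext y
    simp only [D, Finset.mem_filter, Finset.mem_offDiag, Finset.mem_erase]
    tauto

end FinDigraph

/-- For all positive integers `r` and `b`, `c_{rb} ≤ c_r · b`. -/
theorem cMin_mul_le (r b : ℕ) (hr : 1 ≤ r) (hb : 1 ≤ b) :
    cMin (r * b) ≤ cMin r * b := by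
  obtain ⟨D₀, hD₀⟩ := FinDigraph.exists_isRegular r
  obtain ⟨D, hD, hc⟩ := Nat.sInf_mem (s := {k | ∃ D : FinDigraph ℕ, D.IsRegular r ∧ D.cNum = k})
    ⟨_, D₀, hD₀, rfl⟩
  calc cMin (r * b) ≤ (D.blowup b).cNum := Nat.sInf_le ⟨_, hD.blowup hb, rfl⟩
    _ ≤ D.cNum * b := FinDigraph.cNum_blowup_le hD.1 hb
    _ = cMin r * b := by rw [hc, cMin]
end

section
/- For every positive integer r, c_r ≤ 7·⌈r/8⌉. -/
namespace FinDigraph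

section Cycles

variable {V : Type} [DecidableEq V]

/-- A directed cycle through `v` meets every set `S` such that the vertices reachable from `v`
without entering `S` lie in a set `A` that does not contain `v`. -/
theorem IsCycle.exists_mem_of_separates {D : FinDigraph V} {C : List V} (hC : D.IsCycle C) {v : V}
    (hv : v ∈ C) {S : Finset V} {A : Set V} (hA : v ∉ A)
    (h : ∀ a ∈ D.arcs, a.1 ∈ A ∨ a.1 = v → a.2 ∈ A ∨ a.2 ∈ S) : ∃ u ∈ C, u ∈ S := by
  obtain ⟨-, hlen, hchain, hwrap⟩ := hC
  by_contra! hS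
  have hpos : 0 < C.length := by omega
  have harc : ∀ i (hi : i < C.length),
      (C[i], C[(i + 1) % C.length]'(Nat.mod_lt _ hpos)) ∈ D.arcs := by
    intro i hi
    by_cases hlast : i + 1 < C.length
    · simpa only [Nat.mod_eq_of_lt hlast] using List.isChain_iff_getElem.1 hchain i hlast
    · obtain rfl : i = C.length - 1 := by omega
      have h0 : (C.length - 1 + 1) % C.length = 0 := by
        rw [Nat.sub_add_cancel hpos, Nat.mod_self]
      have hne : C ≠ [] := List.length_pos_iff.1 hpos
      simpa only [h0, List.getLast_eq_getElem, List.head_eq_getElem] using hwrap hne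
  obtain ⟨i, hi, rfl⟩ := List.mem_iff_getElem.1 hv
  have hmem : ∀ j, C[(i + j + 1) % C.length]'(Nat.mod_lt _ hpos) ∈ A := by
    intro j
    induction j with
    | zero =>
      exact (h _ (harc i hi) (Or.inr rfl)).resolve_right (hS _ (List.getElem_mem _))
    | succ j ih =>
      have := (h _ (harc _ (Nat.mod_lt _ hpos)) (Or.inl ih)).resolve_right
        (hS _ (List.getElem_mem _))
      simpa only [Nat.mod_add_mod, add_assoc] using this
  apply hA
  have := hmem (C.length - 1)
  have hmod : (i + (C.length - 1) + 1) % C.length = i := by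
    rw [add_assoc, Nat.sub_add_cancel hpos, Nat.add_mod_right, Nat.mod_eq_of_lt hi]
  simpa only [hmod] using this

theorem cNum_le_of_separators (D : FinDigraph V) {m : ℕ}
    (h : ∀ v ∈ D.verts, ∃ (S : Finset V) (A : Set V), S.card ≤ m ∧ v ∉ S ∧ v ∉ A ∧
      ∀ a ∈ D.arcs, a.1 ∈ A ∨ a.1 = v → a.2 ∈ A ∨ a.2 ∈ S) : D.cNum ≤ m := by
  refine csSup_le' ?_
  rintro k ⟨v, C, hv, hC, hdisj⟩
  obtain ⟨S, A, hcard, hvS, hvA, hA⟩ := h v hv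
  choose f hfC hfS using fun i => (hC i).1.exists_mem_of_separates (hC i).2 hvA hA
  have hf : Function.Injective f := by
    intro i j hij
    by_contra hne
    have hmem : ∀ i, f i ∈ (C i).toFinset \ {v} := fun i => by
      simp only [Finset.mem_sdiff, List.mem_toFinset, Finset.mem_singleton]
      exact ⟨hfC i, fun hfv => hvS (hfv ▸ hfS i)⟩
    exact Finset.disjoint_left.1 (hdisj i j hne) (hmem i) (hij ▸ hmem j)
  calc k = (Finset.univ.image f).card := by
        rw [Finset.card_image_of_injective _ hf, Finset.card_univ, Fintype.card_fin]
    _ ≤ S.card := Finset.card_le_card (Finset.image_subset_iff.2 fun i _ => hfS i)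
    _ ≤ m := hcard

end Cycles

section OfPerms

variable {V W : Type} [DecidableEq V] [Fintype W] {r : ℕ}

/-- The digraph on the image of `ι` whose arcs go from each `w` to its images under the
fixed-point-free permutations `σ e`. -/
def ofPerms (ι : W ↪ V) (σ : Fin r → Equiv.Perm W) (hσ : ∀ e w, σ e w ≠ w) : FinDigraph V where
  verts := Finset.univ.map ι
  arcs := Finset.univ.image fun p : W × Fin r => (ι p.1, ι (σ p.2 p.1))
  mem_of_arc := by
    intro a ha
    obtain ⟨p, -, rfl⟩ := Finset.mem_image.1 ha
    exact ⟨Finset.mem_map_of_mem _ (Finset.mem_univ _),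
      Finset.mem_map_of_mem _ (Finset.mem_univ _)⟩
  ne_of_arc := by
    intro a ha
    obtain ⟨p, -, rfl⟩ := Finset.mem_image.1 ha
    exact fun h => hσ _ _ (ι.injective h).symm

theorem ofPerms_isRegular [Nonempty W] (ι : W ↪ V) (σ : Fin r → Equiv.Perm W)
    (hσ : ∀ e w, σ e w ≠ w) (hinj : ∀ w, Function.Injective fun e => σ e w) :
    (ofPerms ι σ hσ).IsRegular r := by
  refine ⟨Finset.univ_nonempty.map, fun v hv => ?_⟩
  obtain ⟨w, -, rfl⟩ := Finset.mem_map.1 hv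
  constructor
  · have : (ofPerms ι σ hσ).arcs.filter (fun a => a.1 = ι w) =
        Finset.univ.image fun e => (ι w, ι (σ e w)) := by
      ext ⟨a, b⟩
      simp only [ofPerms, Finset.mem_filter, Finset.mem_image, Finset.mem_univ, true_and,
        Prod.exists, Prod.mk.injEq]
      constructor
      · rintro ⟨⟨u, e, rfl, rfl⟩, hu⟩
        obtain rfl := ι.injective hu
        exact ⟨e, rfl, rfl⟩
      · rintro ⟨e, rfl, rfl⟩
        exact ⟨⟨w, e, rfl, rfl⟩, rfl⟩
    rw [outDeg, this, Finset.card_image_of_injective, Finset.card_univ, Fintype.card_fin]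
    intro e e' h
    exact hinj w (ι.injective (Prod.ext_iff.1 h).2)
  · have : (ofPerms ι σ hσ).arcs.filter (fun a => a.2 = ι w) =
        Finset.univ.image fun e => (ι ((σ e).symm w), ι w) := by
      ext ⟨a, b⟩
      simp only [ofPerms, Finset.mem_filter, Finset.mem_image, Finset.mem_univ, true_and,
        Prod.exists, Prod.mk.injEq]
      constructor
      · rintro ⟨⟨u, e, rfl, rfl⟩, hu⟩
        exact ⟨e, by rw [← ι.injective hu, Equiv.symm_apply_apply], hu.symm⟩
      · rintro ⟨e, rfl, rfl⟩
        exact ⟨⟨_, e, rfl, by rw [Equiv.apply_symm_apply]⟩, rfl⟩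
    rw [inDeg, this, Finset.card_image_of_injective, Finset.card_univ, Fintype.card_fin]
    intro e e' h
    have hsymm : (σ e).symm w = (σ e').symm w := ι.injective (Prod.ext_iff.1 h).1
    refine hinj ((σ e).symm w) ?_
    change σ e ((σ e).symm w) = σ e' ((σ e).symm w)
    rw [Equiv.apply_symm_apply, hsymm, Equiv.apply_symm_apply]

end OfPerms

end FinDigraph

theorem cMin_le_of_perms {W : Type} [Fintype W] [Nonempty W] {r m : ℕ}
    (σ : Fin r → Equiv.Perm W) (hσ : ∀ e w, σ e w ≠ w)
    (hinj : ∀ w, Function.Injective fun e => σ e w)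
    (hsep : ∀ w, ∃ (S : Finset W) (A : Set W), S.card ≤ m ∧ w ∉ S ∧ w ∉ A ∧
      ∀ u, u ∈ A ∨ u = w → ∀ e, σ e u ∈ A ∨ σ e u ∈ S) : cMin r ≤ m := by
  let ι : W ↪ ℕ := (Fintype.equivFin W).toEmbedding.trans Fin.valEmbedding
  have hmin : cMin r ≤ (FinDigraph.ofPerms ι σ hσ).cNum :=
    Nat.sInf_le ⟨_, FinDigraph.ofPerms_isRegular ι σ hσ hinj, rfl⟩
  refine hmin.trans (FinDigraph.cNum_le_of_separators _ fun v hv => ?_)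
  obtain ⟨w, -, rfl⟩ := Finset.mem_map.1 hv
  obtain ⟨S, A, hcard, hwS, hwA, hA⟩ := hsep w
  refine ⟨S.map ι, ι '' A, by rwa [Finset.card_map], by simpa using hwS, by simpa using hwA, ?_⟩
  intro a ha hau
  obtain ⟨⟨u, e⟩, -, rfl⟩ := Finset.mem_image.1 ha
  have hu : u ∈ A ∨ u = w := by simpa using hau
  simpa using hA u hu e

namespace EightRegular

/-- Vertices of an `8`-regular digraph in which no vertex lies on `8` openly disjoint cycles. -/
abbrev Vertex : Type := Fin 3 × Fin 8

/-- The target block and the shift of the arc of colour `c` leaving block `q`. -/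
def table : Fin 8 → Fin 3 → Vertex :=
  ![![(0, 4), (2, 0), (1, 0)], ![(1, 3), (2, 2), (0, 1)], ![(1, 7), (2, 6), (0, 3)],
    ![(2, 0), (0, 1), (1, 2)], ![(2, 2), (0, 3), (1, 4)], ![(2, 3), (0, 7), (1, 6)],
    ![(2, 4), (1, 2), (0, 5)], ![(2, 6), (1, 6), (0, 7)]]

/-- The out-neighbour of `u` along the arc of colour `c`. -/
def step (c : Fin 8) (u : Vertex) : Vertex := ((table c u.1).1, u.2 + (table c u.1).2)

/-- A set of `7` vertices meeting all cycles through `(q, 0)`. -/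
def separator : Fin 3 → Finset Vertex :=
  ![{(0, 4), (1, 3), (1, 7), (2, 1), (2, 3), (2, 5), (2, 7)},
    {(0, 1), (1, 2), (1, 6), (2, 0), (2, 2), (2, 4), (2, 6)},
    {(0, 1), (0, 3), (0, 5), (0, 7), (1, 0), (1, 2), (1, 6)}]

/-- The vertices reachable from `(q, 0)` without entering `separator q`. -/
def reach : Fin 3 → Finset Vertex :=
  ![{(0, 1), (0, 3), (0, 5), (0, 7), (1, 0), (1, 2), (1, 4), (1, 6),
      (2, 0), (2, 2), (2, 4), (2, 6)},
    {(0, 0), (0, 2), (0, 3), (0, 4), (0, 6), (0, 7), (1, 1), (1, 3), (1, 5), (1, 7),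
      (2, 1), (2, 3), (2, 5), (2, 7)},
    {(1, 4), (2, 2), (2, 4), (2, 6)}]

theorem step_ne (c : Fin 8) (u : Vertex) : step c u ≠ u := by
  revert c u; decide

theorem step_injective (c : Fin 8) : Function.Injective (step c) := by
  have h : ∀ c q q', (table c q).1 = (table c q').1 → q = q' := by decide
  rintro ⟨q, x⟩ ⟨q', x'⟩ huv
  obtain ⟨h₁, h₂⟩ := Prod.ext_iff.1 huv
  obtain rfl : q = q' := h c q q' h₁
  exact Prod.ext rfl (add_right_cancel h₂)

theorem table_injective (q : Fin 3) : Function.Injective fun c => table c q := by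
  revert q; decide

theorem step_colour_injective (u : Vertex) : Function.Injective fun c => step c u := by
  intro c c' h
  obtain ⟨h₁, h₂⟩ := Prod.ext_iff.1 h
  exact table_injective u.1 (Prod.ext h₁ (add_left_cancel h₂))

theorem card_separator (q : Fin 3) : (separator q).card = 7 := by
  revert q; decide

theorem zero_notMem_separator (q : Fin 3) : (q, 0) ∉ separator q := by
  revert q; decide

theorem zero_notMem_reach (q : Fin 3) : (q, 0) ∉ reach q := by
  revert q; decide

theorem step_mem (q : Fin 3) (u : Vertex) (hu : u ∈ reach q ∨ u = (q, 0)) (c : Fin 8) :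
    step c u ∈ reach q ∨ step c u ∈ separator q := by
  revert q u c; decide

/-- Translation of the second coordinate by `-x`. -/
def shift (x : Fin 8) (u : Vertex) : Vertex := (u.1, u.2 - x)

theorem shift_injective (x : Fin 8) : Function.Injective (shift x) := by
  rintro ⟨q, y⟩ ⟨q', y'⟩ h
  obtain ⟨h₁, h₂⟩ := Prod.ext_iff.1 h
  exact Prod.ext h₁ (sub_left_injective h₂)

theorem shift_self (u : Vertex) : shift u.2 u = (u.1, 0) := Prod.ext rfl (sub_self _)

theorem shift_step (x : Fin 8) (c : Fin 8) (u : Vertex) :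
    shift x (step c u) = step c (shift x u) :=
  Prod.ext rfl (add_sub_right_comm _ _ _)

/-- The permutation of the `k`-fold blow-up given by colour `c` and a shift `t` of the fibres. -/
noncomputable def blowUpPerm (k : ℕ) [NeZero k] (c : Fin 8) (t : ZMod k) :
    Equiv.Perm (Vertex × ZMod k) :=
  (Equiv.ofBijective _ (Finite.injective_iff_bijective.1 (step_injective c))).prodCongr
    (Equiv.addRight t)

theorem blowUpPerm_apply (k : ℕ) [NeZero k] (c : Fin 8) (t : ZMod k) (w : Vertex × ZMod k) :
    blowUpPerm k c t w = (step c w.1, w.2 + t) := rfl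

theorem cMin_le {r k : ℕ} [NeZero k] (hrk : r ≤ 8 * k) : cMin r ≤ 7 * k := by
  refine cMin_le_of_perms (W := Vertex × ZMod k)
    (fun e : Fin r => blowUpPerm k (Fin.ofNat 8 e) ((e / 8 : ℕ) : ZMod k)) ?_ ?_ ?_
  · intro e w h
    exact step_ne _ _ (congrArg Prod.fst h)
  · intro w e e' h
    obtain ⟨h₁, h₂⟩ := Prod.ext_iff.1 h
    have hmod : (e : ℕ) % 8 = e' % 8 := congrArg Fin.val (step_colour_injective w.1 h₁)
    have hcast : ((e / 8 : ℕ) : ZMod k) = ((e' / 8 : ℕ) : ZMod k) := add_left_cancel h₂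
    have hdiv : (e : ℕ) / 8 = e' / 8 :=
      Nat.ModEq.eq_of_lt_of_lt ((ZMod.natCast_eq_natCast_iff _ _ _).1 hcast)
        (by omega) (by omega)
    ext
    omega
  · rintro ⟨v, a⟩
    refine ⟨Finset.univ.filter fun p => shift v.2 p.1 ∈ separator v.1,
      {p | shift v.2 p.1 ∈ reach v.1}, ?_, ?_, ?_, ?_⟩
    · calc _ ≤ (separator v.1 ×ˢ (Finset.univ : Finset (ZMod k))).card := by
            refine Finset.card_le_card_of_injOn (fun p => (shift v.2 p.1, p.2)) ?_ ?_
            · intro p hp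
              simpa using hp
            · exact ((shift_injective v.2).prodMap Function.injective_id).injOn
        _ = 7 * k := by rw [Finset.card_product, card_separator, Finset.card_univ, ZMod.card]
    · simpa [shift_self] using zero_notMem_separator v.1
    · simpa [shift_self] using zero_notMem_reach v.1
    · rintro ⟨u, b⟩ hu e
      have hu' : shift v.2 u ∈ reach v.1 ∨ shift v.2 u = (v.1, 0) :=
        hu.imp id fun h => by
          obtain ⟨rfl, -⟩ := Prod.mk.inj h
          exact shift_self u
      simpa [blowUpPerm_apply, shift_step] using step_mem v.1 _ hu' (Fin.ofNat 8 e)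

end EightRegular

/-- For every positive integer `r`, `c_r ≤ 7·⌈r/8⌉`. -/
theorem cMin_le_seven_ceil (r : ℕ) (hr : 1 ≤ r) :
    cMin r ≤ 7 * ⌈(r : ℚ) / 8⌉₊ := by
  have : NeZero ⌈(r : ℚ) / 8⌉₊ := ⟨(Nat.ceil_pos.2 (by positivity)).ne'⟩
  refine EightRegular.cMin_le ?_
  have h := Nat.le_ceil ((r : ℚ) / 8)
  rw [div_le_iff₀ (by norm_num)] at h
  rw [mul_comm]
  exact_mod_cast h
end

section
/- There exists a real number L with 3/22 ≤ L ≤ 7/8 such that the sequence (c_r / r)_{r ≥ 1} converges to L as r → ∞; moreover L = inf_{r ≥ 1} c_r / r. -/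
open Filter

open Finset

namespace FinDigraph

section Cuts

variable {V : Type} [DecidableEq V]

/-- At most `m` vertices other than `v` meet every cycle through `v`: some set `B` avoiding `v`
contains, up to a set `S` of at most `m` vertices other than `v`, all out-neighbours of `v` and of
`B`. -/
def HasCut (D : FinDigraph V) (v : V) (m : ℕ) : Prop :=
  ∃ B S : Finset V, v ∉ B ∧ v ∉ S ∧ #S ≤ m ∧
    ∀ a ∈ D.arcs, a.1 = v ∨ a.1 ∈ B → a.2 ∈ B ∨ a.2 ∈ S

theorem IsCycle.exists_rotation {D : FinDigraph V} {C : List V} {v : V} (h : D.IsCycle C)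
    (hv : v ∈ C) : ∃ l : List V, l ⊆ C ∧
      (v :: (l ++ [v])).IsChain (fun a b => (a, b) ∈ D.arcs) := by
  obtain ⟨-, -, hc, hl⟩ := h
  obtain ⟨s, t, rfl⟩ := List.append_of_mem hv
  have hl := hl (by simp)
  refine ⟨t ++ s, by intro x; simp; tauto, ?_⟩
  have hc : (s ++ v :: t).IsChain (fun a b => (a, b) ∈ D.arcs) := hc
  rw [List.isChain_split] at hc
  have key : v :: (t ++ s ++ [v]) = (v :: t) ++ (s ++ [v]) := by simp
  rw [key, List.isChain_append]
  refine ⟨hc.2, hc.1, ?_⟩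
  intro x hx y hy
  rw [List.getLast_append_of_right_ne_nil _ _ (by simp)] at hl
  rw [List.getLast?_eq_getLast_of_ne_nil (by simp)] at hx
  cases hx
  cases s with
  | nil => simp at hy hl; subst hy; exact hl
  | cons b s => simp at hy hl; subst hy; exact hl

theorem HasCut.exists_mem {D : FinDigraph V} {v : V} {B S : Finset V} (hvB : v ∉ B)
    (hvS : v ∉ S) (hcut : ∀ a ∈ D.arcs, a.1 = v ∨ a.1 ∈ B → a.2 ∈ B ∨ a.2 ∈ S)
    {C : List V} (hC : D.IsCycle C) (hv : v ∈ C) : ∃ s ∈ C, s ∈ S := by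
  by_contra! hno
  obtain ⟨l, hl, hchain⟩ := hC.exists_rotation hv
  have reach : ∀ (l : List V) (x : V), (∀ y ∈ l, y ∉ S) → (x = v ∨ x ∈ B) →
      ¬ (x :: (l ++ [v])).IsChain (fun a b => (a, b) ∈ D.arcs) := by
    intro l
    induction l with
    | nil =>
      intro x _ hx h
      have := hcut (x, v) (by simpa using h) hx
      tauto
    | cons y l ih =>
      intro x hS hx h
      rw [List.cons_append, List.isChain_cons_cons] at h
      have := hcut (x, y) h.1 hx
      exact ih y (fun z hz => hS z (by simp [hz])) (Or.inr (this.resolve_right (hS y (by simp)))) h.2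
  exact reach l v (fun y hy => hno y (hl hy)) (Or.inl rfl) hchain

/-- The easy direction of Menger's theorem. -/
theorem HasCut.le {D : FinDigraph V} {v : V} {m k : ℕ} (hcut : D.HasCut v m) (C : Fin k → List V)
    (hC : ∀ i, D.IsCycle (C i) ∧ v ∈ C i)
    (hdisj : ∀ i j, i ≠ j → Disjoint ((C i).toFinset \ {v}) ((C j).toFinset \ {v})) : k ≤ m := by
  obtain ⟨B, S, hvB, hvS, hm, hcl⟩ := hcut
  choose s hs hsS using fun i => HasCut.exists_mem hvB hvS hcl (hC i).1 (hC i).2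
  refine le_trans ?_ hm
  have hinj : Function.Injective s := by
    intro i j hij
    by_contra hne
    have hd := Finset.disjoint_left.mp (hdisj i j hne)
    refine hd (a := s i) (Finset.mem_sdiff.mpr ⟨by simpa using hs i, ?_⟩)
      (Finset.mem_sdiff.mpr ⟨by simpa [hij] using hs j, ?_⟩)
    all_goals
      rw [mem_singleton]
      exact fun h => hvS (h ▸ hsS i)
  simpa using Finset.card_le_card_of_injOn s (s := univ) (t := S) (by intro i _; exact hsS i)
    hinj.injOn


/-- Iterating an injective self-map of a finite type from a point `x` satisfying `P`, there is a
first positive time at which `P` holds again. -/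
theorem exists_first_return {ι : Type*} [Finite ι] {f : ι → ι} (hf : Function.Injective f)
    {P : ι → Prop} {x : ι} (hx : P x) :
    ∃ n, P (f^[n + 1] x) ∧ ∀ j, 1 ≤ j → j ≤ n → ¬ P (f^[j] x) := by
  classical
  obtain ⟨p, hp, hpx⟩ := hf.mem_periodicPts x
  have hex : ∃ n, P (f^[n + 1] x) := by
    refine ⟨p - 1, ?_⟩
    rw [Nat.sub_add_cancel hp, hpx.eq]
    exact hx
  refine ⟨Nat.find hex, Nat.find_spec hex, fun j h1 h2 hP => ?_⟩
  refine Nat.find_min hex (m := j - 1) (by omega) ?_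
  rwa [Nat.sub_add_cancel h1]

/-- Nontrivial orbit segments between consecutive visits to `P` are disjoint. -/
theorem eq_of_iterate_eq {ι : Type*} {f : ι → ι} (hf : Function.Injective f) {P : ι → Prop}
    {x y : ι} (hx : P x) (hy : P y) {a b n m : ℕ} (ha : a ≤ n) (hb : b ≤ m)
    (hn : ∀ j, 1 ≤ j → j ≤ n → ¬ P (f^[j] x)) (hm : ∀ j, 1 ≤ j → j ≤ m → ¬ P (f^[j] y))
    (h : f^[a] x = f^[b] y) : a = b ∧ x = y := by
  wlog hab : a ≤ b generalizing x y a b n m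
  · obtain ⟨h1, h2⟩ := this hy hx hb ha hm hn h.symm (by omega)
    exact ⟨h1.symm, h2.symm⟩
  obtain ⟨d, rfl⟩ := Nat.exists_eq_add_of_le hab
  rw [Function.iterate_add_apply] at h
  have h := hf.iterate a h
  rcases Nat.eq_zero_or_pos d with rfl | hd
  · exact ⟨rfl, h⟩
  · exact absurd (h ▸ hx) (hm d hd (by omega))

/-- The hard direction of Menger's theorem, for cycles through a vertex. -/
theorem hasOpenCycles_of_not_hasCut {D : FinDigraph V} {v : V} {m : ℕ} (hv : v ∈ D.verts)
    (hcut : ¬ D.HasCut v m) : D.HasOpenCycles (m + 1) := by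
  let W := {u // u ∈ D.verts ∧ u ≠ v}
  have : Finite W := Finite.of_injective (β := D.verts) (fun w => ⟨w.1, w.2.1⟩)
    (fun a b h => Subtype.ext (by simpa using h))
  have : Fintype W := Fintype.ofFinite W
  let q : W ⊕ Fin (m + 1) → V := Sum.elim Subtype.val fun _ => v
  let t : W ⊕ Fin (m + 1) → Finset (W ⊕ Fin (m + 1)) := fun x =>
    univ.filter fun y => (q x, q y) ∈ D.arcs ∨ (x = y ∧ x.isLeft)
  have hall : ∀ s : Finset (W ⊕ Fin (m + 1)), #s ≤ #(s.biUnion t) := by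
    intro s
    have hloop : ∀ w, Sum.inl w ∈ s → Sum.inl w ∈ s.biUnion t := fun w hw =>
      mem_biUnion.mpr ⟨_, hw, by simp [t]⟩
    by_cases hR : ∃ i, Sum.inr i ∈ s
    · obtain ⟨i, hi⟩ := hR
      by_cases hback : ∃ w, Sum.inl w ∈ s ∧ (w.1, v) ∈ D.arcs
      · obtain ⟨w, hw, hwv⟩ := hback
        refine card_le_card ?_
        rintro (x | x) hx
        · exact hloop x hx
        · exact mem_biUnion.mpr ⟨_, hw, by simp [t, q, hwv]⟩
      · set B : Finset V := s.toLeft.map (Function.Embedding.subtype _) with hB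
        have memB : ∀ u, u ∈ B ↔ ∃ w : W, Sum.inl w ∈ s ∧ w.1 = u := by
          intro u; simp [hB]; exact ⟨fun ⟨h, h'⟩ => ⟨_, h', rfl⟩, fun ⟨w, h, h'⟩ => h' ▸ ⟨w.2, h⟩⟩
        set N : Finset V := (D.arcs.filter fun a => a.1 = v ∨ a.1 ∈ B).image Prod.snd with hN
        have memN : ∀ y, y ∈ N ↔ ∃ x, (x, y) ∈ D.arcs ∧ (x = v ∨ x ∈ B) := by
          intro y; simp [hN]
        have hvN : v ∉ N := by
          rw [memN]
          rintro ⟨x, hx, rfl | hxB⟩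
          · exact D.ne_of_arc _ hx rfl
          · obtain ⟨w, hw, rfl⟩ := (memB x).mp hxB
            exact hback ⟨w, hw, hx⟩
        have hvB : v ∉ B := by
          rw [memB]
          rintro ⟨w, -, hw⟩
          exact w.2.2 hw
        have hS : m < #(N \ B) := by
          by_contra hle
          refine hcut ⟨B, N \ B, hvB, fun h => hvN (Finset.mem_sdiff.mp h).1, by omega, ?_⟩
          intro a ha ha1
          by_cases haB : a.2 ∈ B
          · exact Or.inl haB
          · exact Or.inr (Finset.mem_sdiff.mpr ⟨(memN _).mpr ⟨a.1, ha, ha1⟩, haB⟩)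
        have hsub : B ∪ N \ B ⊆ (s.biUnion t).image q := by
          intro y hy
          rcases mem_union.mp hy with hy | hy
          · obtain ⟨w, hw, rfl⟩ := (memB y).mp hy
            exact mem_image.mpr ⟨_, hloop w hw, rfl⟩
          · have hyN := (Finset.mem_sdiff.mp hy).1
            obtain ⟨x, hx, hxv⟩ := (memN y).mp hyN
            have hyW : y ∈ D.verts ∧ y ≠ v :=
              ⟨(D.mem_of_arc _ hx).2, fun h => hvN (h ▸ hyN)⟩
            refine mem_image.mpr ⟨Sum.inl ⟨y, hyW⟩, mem_biUnion.mpr ?_, rfl⟩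
            rcases hxv with rfl | hxB
            · exact ⟨_, hi, by simp [t, q, hx]⟩
            · obtain ⟨w, hw, rfl⟩ := (memB x).mp hxB
              exact ⟨_, hw, by simp [t, q, hx]⟩
        have h1 := card_le_card hsub
        rw [card_union_of_disjoint disjoint_sdiff] at h1
        have h2 : #(s.toRight) ≤ m + 1 := by simpa using card_le_univ s.toRight
        have h3 : #B = #(s.toLeft) := card_map _
        have h4 := s.card_toLeft_add_card_toRight
        have h5 : #((s.biUnion t).image q) ≤ #(s.biUnion t) := card_image_le
        omega
    · refine card_le_card ?_
      rintro (x | x) hx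
      · exact hloop x hx
      · exact absurd ⟨x, hx⟩ hR
  obtain ⟨f, hf, hft⟩ := (all_card_le_biUnion_card_iff_exists_injective t).mp hall
  let P : W ⊕ Fin (m + 1) → Prop := fun x => x.isRight
  have hP : ∀ i, P (Sum.inr i) := fun i => rfl
  choose n hn hn' using fun i : Fin (m + 1) => exists_first_return hf (hP i)
  have qP : ∀ x, P x → q x = v := by
    rintro (x | x) h
    · simp [P] at h
    · rfl
  have qinj : ∀ x y, ¬ P x → q x = q y → x = y := by
    rintro (x | x) (y | y) h hq
    · exact congrArg _ (Subtype.ext hq)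
    · exact absurd hq x.2.2
    · exact absurd (hP x) h
    · exact absurd (hP x) h
  have harc : ∀ i j, (q (f^[j] (Sum.inr i)), q (f^[j + 1] (Sum.inr i))) ∈ D.arcs := by
    intro i j
    have h := hft (f^[j] (Sum.inr i))
    rw [← Function.iterate_succ_apply' f j] at h
    rcases (mem_filter.mp h).2 with h | ⟨h, hl⟩
    · exact h
    · rw [Function.iterate_succ_apply] at h
      have hfix := hf.iterate j h
      rw [Function.iterate_fixed hfix.symm] at hl
      simp at hl
  have hpos : ∀ i, 1 ≤ n i := by
    intro i
    by_contra h0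
    have h0 : n i = 0 := by omega
    have h1 := hn i
    rw [h0] at h1
    exact D.ne_of_arc _ (harc i 0) ((qP _ (hP i)).trans (qP _ h1).symm)
  have hmem : ∀ i x, x ∈ (List.range (n i + 1)).map (fun j => q (f^[j] (Sum.inr i))) → x ≠ v →
      ∃ j, 1 ≤ j ∧ j ≤ n i ∧ q (f^[j] (Sum.inr i)) = x := by
    intro i x hx hxv
    obtain ⟨j, hj, rfl⟩ := List.mem_map.mp hx
    rw [List.mem_range] at hj
    refine ⟨j, ?_, by omega, rfl⟩
    rcases Nat.eq_zero_or_pos j with rfl | h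
    · exact absurd rfl hxv
    · exact h
  refine ⟨v, fun i => (List.range (n i + 1)).map (fun j => q (f^[j] (Sum.inr i))), hv, ?_, ?_⟩
  · intro i
    refine ⟨⟨?_, ?_, ?_, ?_⟩, ?_⟩
    · refine List.Nodup.map_on ?_ List.nodup_range
      intro a ha b hb hab
      rw [List.mem_range] at ha hb
      have key : f^[a] (Sum.inr i) = f^[b] (Sum.inr i) := by
        rcases Nat.eq_zero_or_pos a with rfl | ha0
        · rcases Nat.eq_zero_or_pos b with rfl | hb0
          · rfl
          · exact (qinj _ _ (hn' i b hb0 (by omega)) hab.symm).symm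
        · exact qinj _ _ (hn' i a ha0 (by omega)) hab
      exact (eq_of_iterate_eq hf (hP i) (hP i) (Nat.le_of_lt_succ ha) (Nat.le_of_lt_succ hb)
        (hn' i) (hn' i) key).1
    · have := hpos i
      simp; omega
    · refine List.isChain_iff_getElem.mpr ?_
      intro j hj
      simpa using harc i j
    · intro h
      have h1 := harc i (n i)
      rw [qP _ (hn i)] at h1
      simpa [List.getLast_eq_getElem, List.head_eq_getElem, q] using h1
    · exact List.mem_map.mpr ⟨0, by simp, rfl⟩
  · intro i j hij
    refine Finset.disjoint_left.mpr ?_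
    intro x hx hx'
    simp only [Finset.mem_sdiff, List.mem_toFinset, mem_singleton] at hx hx'
    obtain ⟨a, ha1, ha2, rfl⟩ := hmem i x hx.1 hx.2
    obtain ⟨b, hb1, hb2, hab⟩ := hmem j _ hx'.1 hx'.2
    have := eq_of_iterate_eq hf (hP j) (hP i) hb2 ha2 (hn' j) (hn' i)
      (qinj _ _ (hn' j b hb1 hb2) hab)
    exact hij (Sum.inr_injective this.2).symm

theorem hasCut_card_verts (D : FinDigraph V) (v : V) : D.HasCut v #D.verts :=
  ⟨∅, D.verts.erase v, by simp, by simp, card_le_card (erase_subset _ _), fun a ha h => by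
    have h : a.1 = v := by simpa using h
    exact Or.inr (mem_erase.mpr ⟨fun h2 => D.ne_of_arc a ha (h.trans h2.symm),
      (D.mem_of_arc a ha).2⟩)⟩

theorem cNum_le_iff {D : FinDigraph V} {m : ℕ} :
    D.cNum ≤ m ↔ ∀ v ∈ D.verts, D.HasCut v m := by
  constructor
  · intro h v hv
    by_contra hcut
    have hbdd : BddAbove {k | D.HasOpenCycles k} := by
      refine ⟨#D.verts, ?_⟩
      rintro k ⟨w, C, -, hC, hd⟩
      exact (D.hasCut_card_verts w).le C hC hd
    have := le_csSup hbdd (hasOpenCycles_of_not_hasCut hv hcut)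
    have h' : sSup {k | D.HasOpenCycles k} ≤ m := h
    omega
  · intro h
    refine csSup_le' ?_
    rintro k ⟨v, C, hv, hC, hd⟩
    exact (h v hv).le C hC hd

end Cuts

section Degrees

variable {V : Type} [DecidableEq V]

/-- The out-neighbours of a vertex. -/
def outNbrs (D : FinDigraph V) (v : V) : Finset V := D.verts.filter fun w => (v, w) ∈ D.arcs

/-- The in-neighbours of a vertex. -/
def inNbrs (D : FinDigraph V) (v : V) : Finset V := D.verts.filter fun w => (w, v) ∈ D.arcs

@[simp]
theorem mem_outNbrs {D : FinDigraph V} {v w : V} : w ∈ D.outNbrs v ↔ (v, w) ∈ D.arcs := by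
  simp only [outNbrs, mem_filter, and_iff_right_iff_imp]
  exact fun h => (D.mem_of_arc _ h).2

@[simp]
theorem mem_inNbrs {D : FinDigraph V} {v w : V} : w ∈ D.inNbrs v ↔ (w, v) ∈ D.arcs := by
  simp only [inNbrs, mem_filter, and_iff_right_iff_imp]
  exact fun h => (D.mem_of_arc _ h).1

theorem outDeg_eq_card_s3 (D : FinDigraph V) (v : V) : D.outDeg v = #(D.outNbrs v) := by
  refine card_bij (fun a _ => a.2) ?_ ?_ ?_
  · rintro ⟨x, y⟩ h
    obtain ⟨h, rfl⟩ := mem_filter.mp h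
    simpa using h
  · rintro ⟨x, y⟩ h ⟨x', y'⟩ h' rfl
    rw [mem_filter] at h h'
    exact Prod.ext (h.2.trans h'.2.symm) rfl
  · exact fun w hw => ⟨(v, w), by simpa using hw, rfl⟩

theorem inDeg_eq_card_s3 (D : FinDigraph V) (v : V) : D.inDeg v = #(D.inNbrs v) := by
  refine card_bij (fun a _ => a.1) ?_ ?_ ?_
  · rintro ⟨x, y⟩ h
    obtain ⟨h, rfl⟩ := mem_filter.mp h
    simpa using h
  · rintro ⟨x, y⟩ h ⟨x', y'⟩ h' rfl
    rw [mem_filter] at h h'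
    exact Prod.ext rfl (h.2.trans h'.2.symm)
  · exact fun w hw => ⟨(w, v), by simpa using hw, rfl⟩

end Degrees

section Constructions

/-- The complete digraph on `r + 1` vertices. -/
def complete (r : ℕ) : FinDigraph ℕ where
  verts := range (r + 1)
  arcs := (range (r + 1)).offDiag
  mem_of_arc _ h := ⟨(mem_offDiag.mp h).1, (mem_offDiag.mp h).2.1⟩
  ne_of_arc _ h := (mem_offDiag.mp h).2.2

theorem complete_isRegular (r : ℕ) : (complete r).IsRegular r := by
  refine ⟨⟨0, by simp [complete]⟩, fun v hv => ?_⟩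
  have hv' : v ∈ range (r + 1) := hv
  have h : #((range (r + 1)).erase v) = r := by simp [card_erase_of_mem hv']
  rw [outDeg_eq_card_s3, inDeg_eq_card_s3]
  constructor
  · refine Eq.trans ?_ h
    congr 1
    ext w
    simp only [mem_outNbrs, mem_erase, complete, mem_offDiag]
    tauto
  · refine Eq.trans ?_ h
    congr 1
    ext w
    simp only [mem_inNbrs, mem_erase, complete, mem_offDiag]
    tauto

/-- The preimage of a set under division by `k`. -/
def blowUpSet (k : ℕ) (X : Finset ℕ) : Finset ℕ := X.biUnion fun w => Ico (w * k) (w * k + k)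

theorem mem_blowUpSet {k : ℕ} (hk : 0 < k) {X : Finset ℕ} {x : ℕ} :
    x ∈ blowUpSet k X ↔ x / k ∈ X := by
  have key : ∀ w, x ∈ Ico (w * k) (w * k + k) ↔ x / k = w := by
    intro w
    rw [mem_Ico, Nat.div_eq_iff hk]
    omega
  simp only [blowUpSet, mem_biUnion, key]
  simp

theorem card_blowUpSet {k : ℕ} (hk : 0 < k) (X : Finset ℕ) : #(blowUpSet k X) = k * #X := by
  rw [blowUpSet, card_biUnion]
  · simp [mul_comm]
  · intro a _ b _ hab
    refine Finset.disjoint_left.mpr fun x hx hx' => hab ?_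
    have ha : x ∈ blowUpSet k {a} := by simpa [blowUpSet] using hx
    have hb : x ∈ blowUpSet k {b} := by simpa [blowUpSet] using hx'
    rw [mem_blowUpSet hk, mem_singleton] at ha hb
    exact ha.symm.trans hb

/-- The digraph in which every vertex is replaced by `k` independent copies. -/
def blowUp (D : FinDigraph ℕ) (k : ℕ) : FinDigraph ℕ where
  verts := blowUpSet k D.verts
  arcs := (blowUpSet k D.verts ×ˢ blowUpSet k D.verts).filter fun a => (a.1 / k, a.2 / k) ∈ D.arcs
  mem_of_arc _ h := mem_product.mp (mem_filter.mp h).1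
  ne_of_arc _ h he := D.ne_of_arc _ (mem_filter.mp h).2 (congrArg (· / k) he)

theorem mem_blowUp_arcs {D : FinDigraph ℕ} {k : ℕ} (hk : 0 < k) {x y : ℕ} :
    (x, y) ∈ (D.blowUp k).arcs ↔ (x / k, y / k) ∈ D.arcs := by
  simp only [blowUp, mem_filter, mem_product, mem_blowUpSet hk, and_iff_right_iff_imp]
  exact fun h => D.mem_of_arc _ h

theorem IsRegular.blowUp {D : FinDigraph ℕ} {r k : ℕ} (hD : D.IsRegular r) (hk : 0 < k) :
    (D.blowUp k).IsRegular (k * r) := by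
  obtain ⟨⟨w, hw⟩, hdeg⟩ := hD
  refine ⟨⟨w * k, (mem_blowUpSet hk).mpr (by rwa [Nat.mul_div_cancel _ hk])⟩, fun v hv => ?_⟩
  obtain ⟨h1, h2⟩ := hdeg _ ((mem_blowUpSet hk).mp hv)
  rw [outDeg_eq_card_s3] at h1 ⊢
  rw [inDeg_eq_card_s3] at h2 ⊢
  rw [← h1]
  constructor
  · rw [← card_blowUpSet hk]
    congr 1
    ext x
    rw [mem_blowUpSet hk, mem_outNbrs, mem_outNbrs, mem_blowUp_arcs hk]
  · rw [h1, ← h2, ← card_blowUpSet hk]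
    congr 1
    ext x
    rw [mem_blowUpSet hk, mem_inNbrs, mem_inNbrs, mem_blowUp_arcs hk]

theorem cNum_blowUp_le (D : FinDigraph ℕ) {k : ℕ} (hk : 0 < k) :
    (D.blowUp k).cNum ≤ k * D.cNum := by
  refine cNum_le_iff.mpr fun v hv => ?_
  obtain ⟨B, S, hvB, hvS, hS, hcut⟩ := cNum_le_iff.mp le_rfl (v / k) ((mem_blowUpSet hk).mp hv)
  refine ⟨blowUpSet k B, blowUpSet k S, ?_, ?_, ?_, ?_⟩
  · rwa [mem_blowUpSet hk]
  · rwa [mem_blowUpSet hk]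
  · rw [card_blowUpSet hk]
    exact Nat.mul_le_mul_left k hS
  · rintro ⟨x, y⟩ ha h
    simp only [mem_blowUpSet hk] at h ⊢
    refine hcut (x / k, y / k) ((mem_blowUp_arcs hk).mp ha) (h.imp_left ?_)
    rintro rfl
    rfl

/-- A regular digraph of positive degree has a spanning subdigraph in which all in- and
out-degrees are one. -/
theorem IsRegular.exists_factor {D : FinDigraph ℕ} {n : ℕ} (hD : D.IsRegular (n + 1)) :
    ∃ g : ℕ → ℕ, (∀ v ∈ D.verts, (v, g v) ∈ D.arcs) ∧
      ∀ w ∈ D.verts, ∃ v ∈ D.verts, ∀ u ∈ D.verts, g u = w ↔ u = v := by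
  have hall : ∀ s : Finset D.verts, #s ≤ #(s.biUnion fun v => D.outNbrs v) := by
    intro s
    have h := card_mul_le_card_mul (s := s) (t := s.biUnion fun v => D.outNbrs v)
      (fun v w => (v.1, w) ∈ D.arcs) (m := n + 1) (n := n + 1) ?_ ?_
    · exact Nat.le_of_mul_le_mul_right h n.succ_pos
    · intro v hv
      rw [← (hD.2 v v.2).1, outDeg_eq_card_s3]
      refine card_le_card fun w hw => ?_
      rw [mem_bipartiteAbove]
      exact ⟨mem_biUnion.mpr ⟨v, hv, hw⟩, mem_outNbrs.mp hw⟩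
    · intro w hw
      obtain ⟨v, -, hvw⟩ := mem_biUnion.mp hw
      rw [← (hD.2 w (D.mem_of_arc _ (mem_outNbrs.mp hvw)).2).2, inDeg_eq_card_s3]
      refine card_le_card_of_injOn Subtype.val ?_ Subtype.val_injective.injOn
      intro u hu
      have hu := (mem_bipartiteBelow _).mp (mem_coe.mp hu)
      simpa using hu.2
  obtain ⟨f, hf, hft⟩ := (all_card_le_biUnion_card_iff_exists_injective _).mp hall
  have hsurj : univ.image f = D.verts := by
    refine eq_of_subset_of_card_le ?_ ?_
    · intro w hw
      obtain ⟨v, -, rfl⟩ := mem_image.mp hw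
      exact (D.mem_of_arc _ (mem_outNbrs.mp (hft v))).2
    · rw [card_image_of_injective _ hf]
      simp
  have hg : ∀ v (hv : v ∈ D.verts), (if h : v ∈ D.verts then f ⟨v, h⟩ else 0) = f ⟨v, hv⟩ :=
    fun v hv => dif_pos hv
  refine ⟨fun v => if h : v ∈ D.verts then f ⟨v, h⟩ else 0, fun v hv => ?_, fun w hw => ?_⟩
  · simp only [hg v hv]
    exact mem_outNbrs.mp (hft ⟨v, hv⟩)
  · rw [← hsurj] at hw
    obtain ⟨v, -, rfl⟩ := mem_image.mp hw
    refine ⟨v, v.2, fun u hu => ?_⟩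
    simp only [hg u hu]
    rw [hf.eq_iff, Subtype.ext_iff]

theorem IsRegular.exists_pred {D : FinDigraph ℕ} {n : ℕ} (hD : D.IsRegular (n + 1)) :
    ∃ D' : FinDigraph ℕ, D'.IsRegular n ∧ D'.cNum ≤ D.cNum := by
  obtain ⟨g, hg, hg'⟩ := hD.exists_factor
  let D' : FinDigraph ℕ :=
    { verts := D.verts
      arcs := D.arcs.filter fun a => a.2 ≠ g a.1
      mem_of_arc := fun a h => D.mem_of_arc a (mem_filter.mp h).1
      ne_of_arc := fun a h => D.ne_of_arc a (mem_filter.mp h).1 }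
  have harc : ∀ x y, (x, y) ∈ D'.arcs ↔ (x, y) ∈ D.arcs ∧ y ≠ g x := fun x y => mem_filter
  refine ⟨D', ⟨hD.1, fun v hv => ?_⟩, cNum_le_iff.mpr fun v hv => ?_⟩
  · obtain ⟨h1, h2⟩ := hD.2 v hv
    rw [outDeg_eq_card_s3] at h1 ⊢
    rw [inDeg_eq_card_s3] at h2 ⊢
    constructor
    · have : D'.outNbrs v = (D.outNbrs v).erase (g v) := by
        ext x
        simp [harc, and_comm]
      rw [this, card_erase_of_mem (mem_outNbrs.mpr (hg v hv)), h1, Nat.add_sub_cancel]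
    · obtain ⟨u, hu, huv⟩ := hg' v hv
      have : D'.inNbrs v = (D.inNbrs v).erase u := by
        ext x
        simp only [mem_inNbrs, harc, mem_erase, and_comm (a := x ≠ u)]
        refine and_congr_right fun hx => ?_
        rw [ne_comm, Ne, huv x (D.mem_of_arc _ hx).1]
      have hmem : u ∈ D.inNbrs v := by
        have := hg u hu
        rw [(huv u hu).mpr rfl] at this
        simpa using this
      rw [this, card_erase_of_mem hmem, h2, Nat.add_sub_cancel]
  · obtain ⟨B, S, hB, hS, hc, hcut⟩ := (cNum_le_iff (D := D)).mp le_rfl v hv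
    exact ⟨B, S, hB, hS, hc, fun a ha => hcut a (mem_filter.mp ha).1⟩

end Constructions

end FinDigraph

section Limit

open FinDigraph

theorem exists_cNum_eq_cMin (r : ℕ) : ∃ D : FinDigraph ℕ, D.IsRegular r ∧ D.cNum = cMin r :=
  Nat.sInf_mem (s := {k | ∃ D : FinDigraph ℕ, D.IsRegular r ∧ D.cNum = k})
    ⟨_, complete r, complete_isRegular r, rfl⟩

theorem cMin_le_cNum {D : FinDigraph ℕ} {r : ℕ} (hD : D.IsRegular r) : cMin r ≤ D.cNum :=
  Nat.sInf_le ⟨D, hD, rfl⟩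

theorem cMin_mul_le_s3 {k : ℕ} (hk : 0 < k) (r : ℕ) : cMin (k * r) ≤ k * cMin r := by
  obtain ⟨D, hD, hr⟩ := exists_cNum_eq_cMin r
  exact (cMin_le_cNum (hD.blowUp hk)).trans (hr ▸ D.cNum_blowUp_le hk)

theorem cMin_monotone : Monotone cMin := by
  refine monotone_nat_of_le_succ fun n => ?_
  obtain ⟨D, hD, hn⟩ := exists_cNum_eq_cMin (n + 1)
  obtain ⟨D', hD', hle⟩ := hD.exists_pred
  exact (cMin_le_cNum hD').trans (hn ▸ hle)

/-- A Fekete-type lemma for monotone sequences. -/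
theorem tendsto_div_iInf_of_monotone {a : ℕ → ℕ} (hmono : Monotone a)
    (hmul : ∀ k, 0 < k → ∀ r, a (k * r) ≤ k * a r) :
    Tendsto (fun r : ℕ => (a r : ℝ) / r) atTop (nhds (⨅ r : ℕ+, (a r : ℝ) / (r : ℕ))) := by
  have hbdd : BddBelow (Set.range fun r : ℕ+ => (a r : ℝ) / (r : ℕ)) :=
    ⟨0, by rintro _ ⟨r, rfl⟩; positivity⟩
  refine tendsto_order.mpr ⟨fun b hb => ?_, fun b hb => ?_⟩
  · filter_upwards [eventually_gt_atTop 0] with n hn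
    exact hb.trans_le (ciInf_le hbdd ⟨n, hn⟩)
  · obtain ⟨r, hr⟩ := exists_lt_of_ciInf_lt hb
    have hlim : Tendsto (fun n : ℕ => (a r : ℝ) / (r : ℕ) + a r / (n : ℝ)) atTop
        (nhds ((a r : ℝ) / (r : ℕ) + 0)) :=
      tendsto_const_nhds.add (tendsto_const_div_atTop_nhds_zero_nat _)
    rw [add_zero] at hlim
    filter_upwards [hlim.eventually_lt_const hr, eventually_gt_atTop 0] with n hlt hn
    refine lt_of_le_of_lt ?_ hlt
    have h1 : a n ≤ (n / r + 1) * a r := by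
      refine (hmono ?_).trans (hmul _ (Nat.succ_pos _) r)
      rw [mul_comm]
      exact (Nat.lt_mul_div_succ n r.pos).le
    have h2 : (a n : ℝ) ≤ ((n / r : ℕ) + 1) * a r := by exact_mod_cast h1
    have h3 : ((n / r : ℕ) : ℝ) ≤ n / (r : ℕ) := Nat.cast_div_le
    have hn' : (0 : ℝ) < n := by exact_mod_cast hn
    calc (a n : ℝ) / n ≤ ((n / (r : ℕ) + 1) * a r) / n := by gcongr; exact h2.trans (by gcongr)
      _ = _ := by field_simp

end Limit

namespace FinDigraph

section LowerBound

variable {V : Type} [DecidableEq V]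

theorem card_filter_arcs_fst (D : FinDigraph V) (Y : Finset V) (p : V → Prop) [DecidablePred p] :
    #(D.arcs.filter fun a => a.1 ∈ Y ∧ p a.2) = ∑ v ∈ Y, #((D.outNbrs v).filter p) := by
  rw [card_eq_sum_card_fiberwise (f := Prod.fst) (t := Y)
    fun a ha => (mem_filter.mp (mem_coe.mp ha)).2.1]
  refine sum_congr rfl fun v hv => card_bij (fun a _ => a.2) ?_ ?_ ?_
  · rintro ⟨x, y⟩ h
    simp only [mem_filter] at h
    obtain ⟨⟨h, -, hp⟩, rfl⟩ := h
    simpa using ⟨h, hp⟩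
  · rintro ⟨x, y⟩ h ⟨x', y'⟩ h' rfl
    rw [mem_filter] at h h'
    exact Prod.ext (h.2.trans h'.2.symm) rfl
  · intro w hw
    rw [mem_filter, mem_outNbrs] at hw
    exact ⟨(v, w), by simpa [hv] using hw, rfl⟩

theorem card_filter_arcs_snd (D : FinDigraph V) (Y : Finset V) (p : V → Prop) [DecidablePred p] :
    #(D.arcs.filter fun a => a.2 ∈ Y ∧ p a.1) = ∑ v ∈ Y, #((D.inNbrs v).filter p) := by
  rw [card_eq_sum_card_fiberwise (f := Prod.snd) (t := Y)
    fun a ha => (mem_filter.mp (mem_coe.mp ha)).2.1]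
  refine sum_congr rfl fun v hv => card_bij (fun a _ => a.1) ?_ ?_ ?_
  · rintro ⟨x, y⟩ h
    simp only [mem_filter] at h
    obtain ⟨⟨h, -, hp⟩, rfl⟩ := h
    simpa using ⟨h, hp⟩
  · rintro ⟨x, y⟩ h ⟨x', y'⟩ h' rfl
    rw [mem_filter] at h h'
    exact Prod.ext rfl (h.2.trans h'.2.symm)
  · intro w hw
    rw [mem_filter, mem_inNbrs] at hw
    exact ⟨(w, v), by simpa [hv] using hw, rfl⟩

/-- The arcs leaving a set. -/
def leaving (D : FinDigraph V) (Y : Finset V) : Finset (V × V) :=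
  D.arcs.filter fun a => a.1 ∈ Y ∧ a.2 ∉ Y

/-- The arcs entering a set. -/
def entering (D : FinDigraph V) (Y : Finset V) : Finset (V × V) :=
  D.arcs.filter fun a => a.2 ∈ Y ∧ a.1 ∉ Y

theorem card_leaving (D : FinDigraph V) (Y : Finset V) :
    #(D.leaving Y) = ∑ v ∈ Y, #(D.outNbrs v \ Y) := by
  rw [leaving, D.card_filter_arcs_fst Y (· ∉ Y)]
  simp only [sdiff_eq_filter]

theorem card_entering (D : FinDigraph V) (Y : Finset V) :
    #(D.entering Y) = ∑ v ∈ Y, #(D.inNbrs v \ Y) := by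
  rw [entering, D.card_filter_arcs_snd Y (· ∉ Y)]
  simp only [sdiff_eq_filter]

namespace IsRegular

variable {D : FinDigraph V} {r : ℕ}

theorem card_outNbrs (hD : D.IsRegular r) {v : V} (hv : v ∈ D.verts) : #(D.outNbrs v) = r := by
  rw [← outDeg_eq_card_s3, (hD.2 v hv).1]

theorem card_inNbrs (hD : D.IsRegular r) {v : V} (hv : v ∈ D.verts) : #(D.inNbrs v) = r := by
  rw [← inDeg_eq_card_s3, (hD.2 v hv).2]

theorem outNbrs_card_eq (hD : D.IsRegular r) (v : V) : #(D.outNbrs v) = #(D.inNbrs v) := by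
  by_cases hv : v ∈ D.verts
  · rw [hD.card_outNbrs hv, hD.card_inNbrs hv]
  · have h1 : D.outNbrs v = ∅ := by
      ext w
      simpa using fun h => hv (D.mem_of_arc _ h).1
    have h2 : D.inNbrs v = ∅ := by
      ext w
      simpa using fun h => hv (D.mem_of_arc _ h).2
    rw [h1, h2]

theorem card_outNbrs_le (hD : D.IsRegular r) (v : V) : #(D.outNbrs v) ≤ r := by
  by_cases hv : v ∈ D.verts
  · exact (hD.card_outNbrs hv).le
  · have h1 : D.outNbrs v = ∅ := by
      ext w
      simpa using fun h => hv (D.mem_of_arc _ h).1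
    simp [h1]

theorem card_leaving_eq (hD : D.IsRegular r) (Y : Finset V) :
    #(D.leaving Y) = #(D.entering Y) := by
  have h1 := D.card_filter_arcs_fst Y (· ∈ Y)
  have h2 := D.card_filter_arcs_snd Y (· ∈ Y)
  have h3 : ∑ v ∈ Y, #(D.outNbrs v) = ∑ v ∈ Y, #(D.inNbrs v) :=
    sum_congr rfl fun v _ => hD.outNbrs_card_eq v
  have h4 : #(D.arcs.filter fun a => a.1 ∈ Y ∧ a.2 ∈ Y) =
      #(D.arcs.filter fun a => a.2 ∈ Y ∧ a.1 ∈ Y) := by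
    simp only [and_comm]
  have h5 : ∑ v ∈ Y, #(D.outNbrs v) =
      ∑ v ∈ Y, #((D.outNbrs v).filter (· ∈ Y)) + #(D.leaving Y) := by
    rw [card_leaving, ← sum_add_distrib]
    refine sum_congr rfl fun v _ => ?_
    rw [sdiff_eq_filter, card_filter_add_card_filter_not]
  have h6 : ∑ v ∈ Y, #(D.inNbrs v) =
      ∑ v ∈ Y, #((D.inNbrs v).filter (· ∈ Y)) + #(D.entering Y) := by
    rw [card_entering, ← sum_add_distrib]
    refine sum_congr rfl fun v _ => ?_
    rw [sdiff_eq_filter, card_filter_add_card_filter_not]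
  omega

theorem card_arcs_from_le (hD : D.IsRegular r) (S : Finset V) :
    #(D.arcs.filter fun a => a.1 ∈ S) ≤ #S * r := by
  have h := D.card_filter_arcs_fst S fun _ => True
  simp only [and_true, filter_true] at h
  rw [h]
  exact sum_le_card_nsmul _ _ _ fun v _ => hD.card_outNbrs_le v

theorem card_arcs_to_le (hD : D.IsRegular r) (S : Finset V) :
    #(D.arcs.filter fun a => a.2 ∈ S) ≤ #S * r := by
  have h := D.card_filter_arcs_snd S fun _ => True
  simp only [and_true, filter_true] at h
  rw [h]
  exact sum_le_card_nsmul _ _ _ fun v _ => hD.outNbrs_card_eq v ▸ hD.card_outNbrs_le v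

theorem three_mul_le (hD : D.IsRegular r) : 3 * r ≤ 22 * D.cNum := by
  by_contra! hlt
  set c := D.cNum with hc
  have hcut : ∀ v ∈ D.verts, D.HasCut v c := cNum_le_iff.mp hc.ge
  choose! B S hvB hvS hS hcl using hcut
  have h_out : ∀ u ∈ D.verts, D.outNbrs u ⊆ B u ∪ S u := fun u hu w hw =>
    mem_union.mpr (hcl u hu _ (mem_outNbrs.mp hw) (Or.inl rfl))
  have h_in : ∀ u ∈ D.verts, ∀ w ∈ D.inNbrs u, w ∉ insert u (B u) := by
    intro u hu w hw hwB
    have ha := mem_inNbrs.mp hw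
    rcases mem_insert.mp hwB with rfl | hwB
    · exact D.ne_of_arc _ ha rfl
    · rcases hcl u hu _ ha (Or.inr hwB) with h | h
      · exact hvB u hu h
      · exact hvS u hu h
  have quad : ∀ Y ⊆ D.verts, #Y * (2 * r) ≤ 2 * #(D.leaving Y) + #Y * (#Y + c) := by
    intro Y hY
    have h : ∀ v ∈ Y, 2 * r ≤ #(D.outNbrs v \ Y) + #(D.inNbrs v \ Y) + (#Y + c) := by
      intro v hvY
      have hv := hY hvY
      have h1 := card_sdiff_add_card_inter (D.outNbrs v) Y
      have h2 := card_sdiff_add_card_inter (D.inNbrs v) Y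
      have h3 := card_union_add_card_inter (D.outNbrs v ∩ Y) (D.inNbrs v ∩ Y)
      have h4 : #(D.outNbrs v ∩ Y ∪ D.inNbrs v ∩ Y) ≤ #Y :=
        card_le_card (union_subset inter_subset_right inter_subset_right)
      have h5 : #(D.outNbrs v ∩ Y ∩ (D.inNbrs v ∩ Y)) ≤ #(S v) := by
        refine card_le_card fun w hw => ?_
        simp only [mem_inter] at hw
        rcases mem_union.mp (h_out v hv hw.1.1) with hwB | hwS
        · exact absurd (mem_insert_of_mem hwB) (h_in v hv w hw.2.1)
        · exact hwS
      have h6 := hS v hv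
      rw [hD.card_outNbrs hv] at h1
      rw [hD.card_inNbrs hv] at h2
      omega
    have h1 := sum_le_sum h
    simp only [sum_const, smul_eq_mul, sum_add_distrib (s := Y)] at h1
    rw [← card_leaving, ← card_entering, ← hD.card_leaving_eq] at h1
    linarith
  have hverts : #(D.leaving D.verts) = 0 := by
    rw [card_eq_zero, leaving, filter_eq_empty_iff]
    exact fun a ha h => h.2 (D.mem_of_arc a ha).2
  have hcard : r ≤ #D.verts := by
    obtain ⟨v, hv⟩ := hD.1
    rw [← hD.card_outNbrs hv]
    exact card_le_card (filter_subset _ _)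
  obtain ⟨X, hX, hmin⟩ := exists_min_image
    (D.verts.powerset.filter fun Y => 2 * r ≤ 5 * #Y ∧ #(D.leaving Y) ≤ 2 * (c * r)) card
    ⟨D.verts, by simp only [mem_filter, mem_powerset, Subset.rfl, true_and]; omega⟩
  simp only [mem_filter, mem_powerset] at hX hmin
  obtain ⟨hXV, hXr, hXl⟩ := hX
  have hXbig : 7 * r < 5 * #X := by
    by_contra! hle
    have h1 := quad X hXV
    zify at *
    nlinarith [mul_nonneg (sub_nonneg.mpr hXr) (sub_nonneg.mpr hle)]
  obtain ⟨u, huX, hP, hQ⟩ : ∃ u ∈ X, 2 * r ≤ 5 * #(X ∩ insert u (B u)) ∧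
      2 * r ≤ 5 * #(X \ (insert u (B u) ∪ S u)) := by
    by_contra! hno
    have h : ∀ u ∈ X, 3 * r ≤ 5 * #(D.outNbrs u \ X) + 5 * #(D.inNbrs u \ X) + 5 * c := by
      intro u huX
      have hu := hXV huX
      have h1 : #(D.outNbrs u) ≤
          #(D.outNbrs u \ X ∪ X ∩ insert u (B u) ∪ S u) := by
        refine card_le_card fun w hw => ?_
        have := mem_union.mp (h_out u hu hw)
        simp only [mem_union, Finset.mem_sdiff, mem_inter, mem_insert]
        tauto
      have h2 : #(D.inNbrs u) ≤
          #(D.inNbrs u \ X ∪ X \ (insert u (B u) ∪ S u) ∪ S u) := by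
        refine card_le_card fun w hw => ?_
        have := h_in u hu w hw
        simp only [mem_union, Finset.mem_sdiff]
        tauto
      have h3 := card_union_le (D.outNbrs u \ X ∪ X ∩ insert u (B u)) (S u)
      have h4 := card_union_le (D.outNbrs u \ X) (X ∩ insert u (B u))
      have h5 := card_union_le (D.inNbrs u \ X ∪ X \ (insert u (B u) ∪ S u)) (S u)
      have h6 := card_union_le (D.inNbrs u \ X) (X \ (insert u (B u) ∪ S u))
      have h7 := hS u hu
      have h8 := hno u huX
      rw [hD.card_outNbrs hu] at h1
      rw [hD.card_inNbrs hu] at h2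
      omega
    have h1 := sum_le_sum h
    simp only [sum_const, smul_eq_mul, sum_add_distrib (s := X), ← mul_sum] at h1
    rw [← card_leaving, ← card_entering, ← hD.card_leaving_eq] at h1
    zify at *
    nlinarith
  have hu := hXV huX
  set P := X ∩ insert u (B u)
  set Q := X \ (insert u (B u) ∪ S u)
  have hPX : P ⊆ X := inter_subset_left
  have hQX : Q ⊆ X := sdiff_subset
  have hPQ : Disjoint P Q := by
    refine Finset.disjoint_left.mpr fun w hwP hwQ => ?_
    exact (Finset.mem_sdiff.mp hwQ).2 (mem_union_left _ (mem_inter.mp hwP).2)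
  have hcardPQ : #P + #Q ≤ #X := by
    rw [← card_union_of_disjoint hPQ]
    exact card_le_card (union_subset hPX hQX)
  have hPl : 2 * (c * r) < #(D.leaving P) := by
    by_contra! h
    have := hmin P ⟨hPX.trans hXV, hP, h⟩
    omega
  have hQl : 2 * (c * r) < #(D.leaving Q) := by
    by_contra! h
    have := hmin Q ⟨hQX.trans hXV, hQ, h⟩
    omega
  have hXP : #(D.entering P) ≤ #((D.entering X).filter fun a => a.2 ∈ P) +
      #(D.entering (insert u (B u))) := by
    refine (card_le_card ?_).trans (card_union_le _ _)
    intro a ha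
    simp only [entering, mem_filter, mem_union, P, mem_inter] at ha ⊢
    tauto
  have hXQ : #(D.entering Q) ≤ #((D.entering X).filter fun a => a.2 ∈ Q) +
      #(D.arcs.filter fun a => a.1 ∈ S u) := by
    refine (card_le_card ?_).trans (card_union_le _ _)
    intro a ha
    have h1 := hcl u hu a
    simp only [entering, mem_filter, mem_union, Q, Finset.mem_sdiff, mem_insert] at ha ⊢
    tauto
  have hXu : #(D.leaving (insert u (B u))) ≤ #(D.arcs.filter fun a => a.2 ∈ S u) := by
    refine card_le_card fun a ha => ?_
    have h1 := hcl u hu a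
    simp only [leaving, mem_filter, mem_insert] at ha ⊢
    tauto
  have hX2 : #((D.entering X).filter fun a => a.2 ∈ P) +
      #((D.entering X).filter fun a => a.2 ∈ Q) ≤ #(D.entering X) := by
    rw [← card_union_of_disjoint]
    · exact card_le_card (union_subset (filter_subset _ _) (filter_subset _ _))
    · refine Finset.disjoint_left.mpr fun a h1 h2 => ?_
      exact Finset.disjoint_left.mp hPQ (mem_filter.mp h1).2 (mem_filter.mp h2).2
  have h1 := hD.card_arcs_from_le (S u)
  have h2 := hD.card_arcs_to_le (S u)
  have h3 : #(S u) * r ≤ c * r := Nat.mul_le_mul_right r (hS u hu)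
  have h4 := hD.card_leaving_eq P
  have h5 := hD.card_leaving_eq Q
  have h6 := hD.card_leaving_eq X
  have h7 := hD.card_leaving_eq (insert u (B u))
  omega

end IsRegular

end LowerBound

end FinDigraph

section Example

open FinDigraph

/-- The elements of `{0, …, 26}` whose bits are set in `m`. -/
def bitSet (m : ℕ) : Finset ℕ := (range 27).filter fun i => m.testBit i

/-- Bit masks of the out-neighbourhoods of an `8`-regular digraph on `{0, …, 26}`. -/
def outMasks : List ℕ :=
  [8160, 8160, 8160, 8160, 8160, 517184, 129792, 124512, 419040, 424320, 516640, 520448, 518272,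
    118456320, 118456320, 133693440, 133693440, 133693440, 133693440, 23068703, 6815775, 79691807,
    42991647, 19922975, 6815775, 76546079, 42991647]

/-- Bit masks of pairs `(B, S)` such that `S` separates a vertex of the digraph given by
`outMasks` from itself, with `B` the set of vertices reachable from it outside `S`. -/
def cutMasks : List (ℕ × ℕ) :=
  [(8160, 516096), (8160, 516096), (8160, 516096), (8160, 516096), (8160, 516096),
    (134209536, 1119), (134216192, 415), (134210592, 607), (134210720, 607), (134215680, 415),
    (134209536, 575), (134209536, 4383), (134209536, 2207), (134184960, 31), (134184960, 31),
    (133693440, 31), (133693440, 31), (133693440, 31), (133693440, 31), (115343360, 17825823),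
    (17301504, 6291487), (104857600, 9437215), (100663296, 9437215), (18350080, 6291487),
    (108003328, 8912927), (28835840, 71303199), (30932992, 35651615)]

/-- An `8`-regular digraph in which no vertex lies on `8` openly disjoint cycles. -/
def eightRegular : FinDigraph ℕ where
  verts := range 27
  arcs := (range 27 ×ˢ range 27).filter fun a => (outMasks.getD a.1 0).testBit a.2
  mem_of_arc _ h := mem_product.mp (mem_filter.mp h).1
  ne_of_arc a h he := by
    obtain ⟨h1, h2⟩ := mem_filter.mp h
    have key : ∀ i ∈ range 27, ¬ (outMasks.getD i 0).testBit i := by decide +kernel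
    exact key a.1 (mem_product.mp h1).1 (by rwa [← he] at h2)

theorem eightRegular_isRegular : eightRegular.IsRegular 8 :=
  ⟨⟨0, by simp [eightRegular]⟩, by decide +kernel⟩

theorem cNum_eightRegular_le : eightRegular.cNum ≤ 7 := by
  refine cNum_le_iff.mpr fun v hv => ?_
  have key : ∀ v ∈ range 27, v ∉ bitSet (cutMasks.getD v 0).1 ∧
      v ∉ bitSet (cutMasks.getD v 0).2 ∧ #(bitSet (cutMasks.getD v 0).2) ≤ 7 ∧
      ∀ a ∈ eightRegular.arcs, a.1 = v ∨ a.1 ∈ bitSet (cutMasks.getD v 0).1 →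
        a.2 ∈ bitSet (cutMasks.getD v 0).1 ∨ a.2 ∈ bitSet (cutMasks.getD v 0).2 := by
    decide +kernel
  exact ⟨_, _, key v hv⟩

end Example

/-- There exists a real number `L` with `3/22 ≤ L ≤ 7/8` such that
`c_r / r` converges to `L` as `r → ∞`, and moreover `L = inf_{r ≥ 1} c_r / r`. -/
theorem cMin_div_tendsto :
    ∃ L : ℝ, 3 / 22 ≤ L ∧ L ≤ 7 / 8 ∧
      Tendsto (fun r : ℕ => (cMin r : ℝ) / r) atTop (nhds L) ∧
      L = ⨅ r : ℕ+, (cMin r : ℝ) / (r : ℕ) := by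
  have hlow : ∀ r : ℕ+, (3 / 22 : ℝ) ≤ (cMin r : ℝ) / (r : ℕ) := by
    intro r
    obtain ⟨D, hD, hr⟩ := exists_cNum_eq_cMin r
    have h : 3 * (r : ℕ) ≤ 22 * cMin r := hr ▸ hD.three_mul_le
    have h' : 3 * ((r : ℕ) : ℝ) ≤ 22 * cMin r := by exact_mod_cast h
    have hpos : (0 : ℝ) < (r : ℕ) := by exact_mod_cast r.pos
    rw [div_le_div_iff₀ (by norm_num) hpos]
    linarith
  refine ⟨_, le_ciInf hlow, ?_,
    tendsto_div_iInf_of_monotone cMin_monotone fun k hk r => cMin_mul_le_s3 hk r, rfl⟩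
  refine (ciInf_le ⟨3 / 22, by rintro _ ⟨r, rfl⟩; exact hlow r⟩ 8).trans ?_
  have h : cMin 8 ≤ 7 := (cMin_le_cNum eightRegular_isRegular).trans cNum_eightRegular_le
  have h' : (cMin 8 : ℝ) ≤ 7 := by exact_mod_cast h
  change (cMin 8 : ℝ) / (8 : ℕ) ≤ 7 / 8
  rw [Nat.cast_ofNat]
  linarith
end

section
/- Let r be a positive integer and β, γ > 0 real numbers. Every (r,β,γ)-dense digraph D contains an (r,β,γ)-dense subdigraph D' such that for every partition (X,Y) of V(D') with |X| ≥ γr and |Y| ≥ γr, the number of arcs of D' between X and Y (counting both directions) satisfies a_{D'}[X,Y] > βr². -/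
namespace FinDigraph

variable {V : Type} [DecidableEq V]

/-- A digraph `D` is `(r,β,γ)`-dense if `v(D) ≥ γr` and `a(D) ≥ r·v(D) − βr²`. -/
def IsDense (D : FinDigraph V) (r : ℕ) (β γ : ℝ) : Prop :=
  γ * r ≤ (D.verts.card : ℝ) ∧ (r : ℝ) * D.verts.card - β * r ^ 2 ≤ (D.arcs.card : ℝ)

/-- `D′` is a subdigraph of `D`. -/
def IsSubdigraph (D1 D : FinDigraph V) : Prop :=
  D1.verts ⊆ D.verts ∧ D1.arcs ⊆ D.arcs

/-- `a_D[X,Y]`: the number of arcs of `D` between `X` and `Y`, in either direction. -/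
def arcsBetween (D : FinDigraph V) (X Y : Finset V) : ℕ :=
  (D.arcs.filter fun a => (a.1 ∈ X ∧ a.2 ∈ Y) ∨ (a.1 ∈ Y ∧ a.2 ∈ X)).card

end FinDigraph

namespace FinDigraph

/-- The subdigraph of `D` induced on the vertices lying in `X`. -/
def induce {V : Type} [DecidableEq V] (D : FinDigraph V) (X : Finset V) : FinDigraph V where
  verts := D.verts ∩ X
  arcs := D.arcs.filter fun a => a.1 ∈ X ∧ a.2 ∈ X
  mem_of_arc a ha := by
    obtain ⟨ha, h1, h2⟩ := Finset.mem_filter.1 ha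
    exact ⟨Finset.mem_inter.2 ⟨(D.mem_of_arc a ha).1, h1⟩,
      Finset.mem_inter.2 ⟨(D.mem_of_arc a ha).2, h2⟩⟩
  ne_of_arc a ha := D.ne_of_arc a (Finset.mem_filter.1 ha).1

theorem induce_isSubdigraph {V : Type} [DecidableEq V] (D : FinDigraph V) (X : Finset V) :
    (D.induce X).IsSubdigraph D :=
  ⟨Finset.inter_subset_left, Finset.filter_subset _ _⟩

theorem IsSubdigraph.trans {V : Type} [DecidableEq V] {D₁ D₂ D₃ : FinDigraph V}
    (h₁ : D₁.IsSubdigraph D₂) (h₂ : D₂.IsSubdigraph D₃) : D₁.IsSubdigraph D₃ :=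
  ⟨h₁.1.trans h₂.1, h₁.2.trans h₂.2⟩

theorem card_arcs_le_induce_add_induce_add_arcsBetween {V : Type} [DecidableEq V]
    (D : FinDigraph V) {X Y : Finset V} (h : D.verts ⊆ X ∪ Y) :
    D.arcs.card ≤ (D.induce X).arcs.card + (D.induce Y).arcs.card + D.arcsBetween X Y := by
  have hsub : D.arcs ⊆ ((D.induce X).arcs ∪ (D.induce Y).arcs) ∪
      D.arcs.filter fun a => (a.1 ∈ X ∧ a.2 ∈ Y) ∨ (a.1 ∈ Y ∧ a.2 ∈ X) := by
    intro a ha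
    have h1 := Finset.mem_union.1 (h (D.mem_of_arc a ha).1)
    have h2 := Finset.mem_union.1 (h (D.mem_of_arc a ha).2)
    simp only [induce, Finset.mem_union, Finset.mem_filter]
    tauto
  exact (Finset.card_le_card hsub).trans
    ((Finset.card_union_le _ _).trans (Nat.add_le_add_right (Finset.card_union_le _ _) _))

/-- If a dense digraph has a partition into two large parts with few arcs between them,
then one of the parts induces a dense subdigraph. -/
theorem IsDense.induce_or_induce {V : Type} [DecidableEq V] {D : FinDigraph V} {r : ℕ}
    {β γ : ℝ} (hD : D.IsDense r β γ) {X Y : Finset V} (hXY : X ∪ Y = D.verts)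
    (hdisj : Disjoint X Y) (hX : γ * r ≤ (X.card : ℝ)) (hY : γ * r ≤ (Y.card : ℝ))
    (hb : (D.arcsBetween X Y : ℝ) ≤ β * r ^ 2) :
    (D.induce X).IsDense r β γ ∨ (D.induce Y).IsDense r β γ := by
  have hvX : (D.induce X).verts = X :=
    Finset.inter_eq_right.2 (hXY ▸ Finset.subset_union_left)
  have hvY : (D.induce Y).verts = Y :=
    Finset.inter_eq_right.2 (hXY ▸ Finset.subset_union_right)
  by_contra! hcon
  obtain ⟨hnX, hnY⟩ := hcon
  simp only [IsDense, hvX, hX, true_and, not_le] at hnX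
  simp only [IsDense, hvY, hY, true_and, not_le] at hnY
  have hcard : (D.verts.card : ℝ) = X.card + Y.card := by
    rw [← hXY, Finset.card_union_of_disjoint hdisj, Nat.cast_add]
  have harcs : (D.arcs.card : ℝ) ≤
      (D.induce X).arcs.card + (D.induce Y).arcs.card + D.arcsBetween X Y := by
    exact_mod_cast D.card_arcs_le_induce_add_induce_add_arcsBetween hXY.ge
  have hdense := hD.2
  rw [hcard, mul_add] at hdense
  linarith

end FinDigraph

/-- Every `(r,β,γ)`-dense digraph contains an `(r,β,γ)`-dense
subdigraph `D'` such that every partition `(X,Y)` of `V(D')` with `|X|,|Y| ≥ γr`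
satisfies `a_{D'}[X,Y] > βr²`. -/
theorem exists_dense_edge_connected_subdigraph {V : Type} [DecidableEq V]
    (r : ℕ) (hr : 1 ≤ r) (β γ : ℝ) (hβ : 0 < β) (hγ : 0 < γ)
    (D : FinDigraph V) (hD : D.IsDense r β γ) :
    ∃ D' : FinDigraph V, D'.IsSubdigraph D ∧ D'.IsDense r β γ ∧
      ∀ X Y : Finset V, X ∪ Y = D'.verts → Disjoint X Y →
        γ * r ≤ (X.card : ℝ) → γ * r ≤ (Y.card : ℝ) →
        β * r ^ 2 < (D'.arcsBetween X Y : ℝ) := by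
  induction hn : D.verts.card using Nat.strong_induction_on generalizing D with
  | _ n ih =>
  by_cases hgood : ∀ X Y : Finset V, X ∪ Y = D.verts → Disjoint X Y →
      γ * r ≤ (X.card : ℝ) → γ * r ≤ (Y.card : ℝ) → β * r ^ 2 < (D.arcsBetween X Y : ℝ)
  · exact ⟨D, ⟨subset_rfl, subset_rfl⟩, hD, hgood⟩
  push Not at hgood
  obtain ⟨X, Y, hXY, hdisj, hX, hY, hb⟩ := hgood
  have hpos : 0 < γ * r := mul_pos hγ (Nat.cast_pos.2 hr)
  have hXpos : 0 < X.card := Nat.cast_pos.1 (hpos.trans_le hX)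
  have hYpos : 0 < Y.card := Nat.cast_pos.1 (hpos.trans_le hY)
  have hcard : X.card + Y.card = n := by
    rw [← hn, ← hXY, Finset.card_union_of_disjoint hdisj]
  have descend (Z : Finset V) (hZ : Z.card < n) (hdense : (D.induce Z).IsDense r β γ) :
      ∃ D' : FinDigraph V, D'.IsSubdigraph D ∧ D'.IsDense r β γ ∧
        ∀ X Y : Finset V, X ∪ Y = D'.verts → Disjoint X Y →
          γ * r ≤ (X.card : ℝ) → γ * r ≤ (Y.card : ℝ) →
          β * r ^ 2 < (D'.arcsBetween X Y : ℝ) := by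
    obtain ⟨D', hsub, hD'⟩ := ih _
      ((Finset.card_le_card Finset.inter_subset_right).trans_lt hZ) (D.induce Z) hdense rfl
    exact ⟨D', hsub.trans (D.induce_isSubdigraph Z), hD'⟩
  rcases hD.induce_or_induce hXY hdisj hX hY hb with h | h
  · exact descend X (by omega) h
  · exact descend Y (by omega) h
end

section
/- Let r be a positive integer and let α, β, γ, δ > 0 be real numbers such that 2β < (1 − α/2)², γ ≥ (1 − α/2) − √((1 − α/2)² − 2β), 0 < δ < min{1/2, 1 − √β}, (1 − α/2) + √((1 − α/2)² − 2β) ≥ 2((1 − δ) − √((1 − δ)² − β)), and β/(1/2 − δ) ≤ 2((1 − δ) + √((1 − δ)² − β)). Then every (r,β,γ)-dense digraph D with maximum out-degree at most r, maximum in-degree at most r, and c(D) < αr contains a vertex v with min{d⁺_D(v), d⁻_D(v)} ≥ δr. -/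
namespace FinDigraph

variable {V : Type} [DecidableEq V]

/-- The vertices joined to `v` by arcs in both directions. -/
def digonNeighbors (D : FinDigraph V) (v : V) : Finset V :=
  D.verts.filter fun w => (v, w) ∈ D.arcs ∧ (w, v) ∈ D.arcs

theorem IsCycle.exists_mem_ne {D : FinDigraph V} {C : List V} (hC : D.IsCycle C) (v : V) :
    ∃ w ∈ D.verts, w ∈ C ∧ w ≠ v := by
  obtain ⟨hnd, hlen, hchain, -⟩ := hC
  match C, hlen with
  | a :: b :: l, _ =>
    have hab : (a, b) ∈ D.arcs := (List.isChain_cons_cons.1 hchain).1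
    have hne := D.ne_of_arc _ hab
    obtain ⟨ha, hb⟩ := D.mem_of_arc _ hab
    by_cases h : a = v
    · exact ⟨b, hb, by simp, fun hb' => hne (h.trans hb'.symm)⟩
    · exact ⟨a, ha, by simp, h⟩

theorem hasOpenCycles_card_digonNeighbors (D : FinDigraph V) {v : V} (hv : v ∈ D.verts) :
    D.HasOpenCycles (D.digonNeighbors v).card := by
  let e := (D.digonNeighbors v).equivFin.symm
  have he : ∀ i, (v, (e i : V)) ∈ D.arcs ∧ ((e i : V), v) ∈ D.arcs := fun i =>
    (Finset.mem_filter.1 (e i).2).2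
  refine ⟨v, fun i => [v, e i], hv, fun i => ⟨⟨?_, ?_, ?_, ?_⟩, by simp⟩, fun i j hij => ?_⟩
  · simpa using D.ne_of_arc _ (he i).1
  · simp
  · exact List.isChain_pair.2 (he i).1
  · intro _
    simpa using (he i).2
  · have hne : (e i : V) ≠ e j := fun h => hij (e.injective (Subtype.ext h))
    rw [Finset.disjoint_left]
    intro x hx hx'
    simp only [Finset.mem_sdiff, List.mem_toFinset, List.mem_cons, List.not_mem_nil, or_false,
      Finset.mem_singleton] at hx hx'
    exact hne ((hx.1.resolve_left hx.2).symm.trans (hx'.1.resolve_left hx.2))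

theorem sum_outDeg (D : FinDigraph V) (S : Finset V) :
    ∑ v ∈ S, D.outDeg v = (D.arcs.filter fun a => a.1 ∈ S).card := by
  rw [Finset.card_eq_sum_card_fiberwise (s := D.arcs.filter fun a => a.1 ∈ S)
    (f := Prod.fst) (t := S) fun a ha => (Finset.mem_filter.1 ha).2]
  refine Finset.sum_congr rfl fun v hv => congrArg Finset.card ?_
  ext a
  simp only [Finset.mem_filter]
  grind

theorem sum_inDeg (D : FinDigraph V) (S : Finset V) :
    ∑ v ∈ S, D.inDeg v = (D.arcs.filter fun a => a.2 ∈ S).card := by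
  rw [Finset.card_eq_sum_card_fiberwise (s := D.arcs.filter fun a => a.2 ∈ S)
    (f := Prod.snd) (t := S) fun a ha => (Finset.mem_filter.1 ha).2]
  refine Finset.sum_congr rfl fun v hv => congrArg Finset.card ?_
  ext a
  simp only [Finset.mem_filter]
  grind

theorem card_arcs_le (D : FinDigraph V) (A : Finset V) :
    D.arcs.card ≤ ∑ v ∈ D.verts \ A, D.outDeg v + ∑ v ∈ A, D.inDeg v +
      (D.arcs.filter fun a => a.1 ∈ A ∧ a.2 ∈ D.verts \ A).card := by
  rw [sum_outDeg, sum_inDeg]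
  refine le_trans (Finset.card_le_card ?_)
    ((Finset.card_union_le _ _).trans (Nat.add_le_add_right (Finset.card_union_le _ _) _))
  intro a ha
  have := D.mem_of_arc a ha
  simp only [Finset.mem_union, Finset.mem_filter, Finset.mem_sdiff]
  tauto

theorem two_mul_card_arcs_le (D : FinDigraph V) :
    2 * D.arcs.card ≤ D.verts.card ^ 2 + ∑ v ∈ D.verts, (D.digonNeighbors v).card := by
  have hdigon : ∑ v ∈ D.verts, (D.digonNeighbors v).card =
      (D.arcs ∩ D.arcs.image Prod.swap).card := by
    rw [← Finset.card_sigma]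
    refine Finset.card_bij (fun x _ => (x.1, x.2)) ?_ ?_ ?_
    · rintro ⟨v, w⟩ h
      simp only [Finset.mem_sigma, digonNeighbors, Finset.mem_filter] at h
      exact Finset.mem_inter.2 ⟨h.2.2.1, Finset.mem_image.2 ⟨(w, v), h.2.2.2, rfl⟩⟩
    · rintro ⟨v, w⟩ _ ⟨v', w'⟩ _ h
      simpa using h
    · rintro ⟨v, w⟩ h
      obtain ⟨h₁, h₂⟩ := Finset.mem_inter.1 h
      obtain ⟨⟨x, y⟩, hxy, hswap⟩ := Finset.mem_image.1 h₂
      obtain ⟨rfl, rfl⟩ := Prod.mk.inj hswap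
      obtain ⟨hv, hw⟩ := D.mem_of_arc _ h₁
      exact ⟨⟨_, _⟩, by simpa [digonNeighbors] using ⟨hv, hw, h₁, hxy⟩, rfl⟩
  have hunion : (D.arcs ∪ D.arcs.image Prod.swap).card ≤ D.verts.card ^ 2 := by
    rw [sq, ← Finset.card_product]
    refine Finset.card_le_card fun a ha => Finset.mem_product.2 ?_
    rcases Finset.mem_union.1 ha with h | h
    · exact D.mem_of_arc a h
    · obtain ⟨b, hb, rfl⟩ := Finset.mem_image.1 h
      exact (D.mem_of_arc b hb).symm
  have hswap : (D.arcs.image Prod.swap).card = D.arcs.card :=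
    Finset.card_image_of_injective _ Prod.swap_injective
  have := Finset.card_union_add_card_inter D.arcs (D.arcs.image Prod.swap)
  omega

theorem two_mul_card_arcs_le_cNum (D : FinDigraph V) :
    2 * D.arcs.card ≤ D.verts.card ^ 2 + D.verts.card * D.cNum := by
  refine D.two_mul_card_arcs_le.trans (Nat.add_le_add_left ?_ _)
  exact Finset.sum_le_card_nsmul _ _ _ fun v hv =>
    (D.hasOpenCycles_card_digonNeighbors hv).le_cNum

/-- If every vertex has out-degree or in-degree less than `d`, then all but fewer than `d * v(D)`
arcs go from one class of some bipartition of the vertices to the other. -/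
theorem exists_card_arcs_lt (D : FinDigraph V) {r : ℕ} {d : ℝ} (hne : D.verts.Nonempty)
    (hout : ∀ v, D.outDeg v ≤ r) (hin : ∀ v, D.inDeg v ≤ r)
    (hlow : ∀ v ∈ D.verts, d ≤ D.outDeg v → (D.inDeg v : ℝ) < d) :
    ∃ a b : ℕ, a + b = D.verts.card ∧ (D.arcs.card : ℝ) < d * D.verts.card + a * b ∧
      (D.arcs.card : ℝ) < d * D.verts.card + r * a ∧
      (D.arcs.card : ℝ) < d * D.verts.card + r * b := by
  classical
  set A := D.verts.filter fun v => d ≤ D.outDeg v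
  have hsub : A ⊆ D.verts := Finset.filter_subset _ _
  set X := D.arcs.filter fun a => a.1 ∈ A ∧ a.2 ∈ D.verts \ A
  have hXab : X.card ≤ A.card * (D.verts \ A).card := by
    rw [← Finset.card_product]
    exact Finset.card_le_card fun a ha => Finset.mem_product.2 (Finset.mem_filter.1 ha).2
  have hXa : X.card ≤ r * A.card := by
    refine (Finset.card_le_card (t := D.arcs.filter fun a => a.1 ∈ A) ?_).trans ?_
    · exact Finset.monotone_filter_right _ fun a _ h => h.1
    · rw [← sum_outDeg, mul_comm]
      exact Finset.sum_le_card_nsmul _ _ _ fun v _ => hout v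
  have hXb : X.card ≤ r * (D.verts \ A).card := by
    refine (Finset.card_le_card (t := D.arcs.filter fun a => a.2 ∈ D.verts \ A) ?_).trans ?_
    · exact Finset.monotone_filter_right _ fun a _ h => h.2
    · rw [← sum_inDeg, mul_comm]
      exact Finset.sum_le_card_nsmul _ _ _ fun v _ => hin v
  have hlt : ((∑ v ∈ D.verts \ A, D.outDeg v + ∑ v ∈ A, D.inDeg v : ℕ) : ℝ) <
      d * D.verts.card := by
    have hsum : ∑ v ∈ D.verts \ A, D.outDeg v + ∑ v ∈ A, D.inDeg v =
        ∑ v ∈ D.verts, if v ∈ A then D.inDeg v else D.outDeg v := by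
      rw [← Finset.sum_sdiff hsub]
      congr 1
      · exact Finset.sum_congr rfl fun v hv => (if_neg (Finset.mem_sdiff.1 hv).2).symm
      · exact Finset.sum_congr rfl fun v hv => (if_pos hv).symm
    rw [hsum, Nat.cast_sum, mul_comm, ← nsmul_eq_mul, ← Finset.sum_const]
    refine Finset.sum_lt_sum_of_nonempty hne fun v hv => ?_
    split_ifs with h
    · exact hlow v hv (Finset.mem_filter.1 h).2
    · by_contra! h'
      exact h (Finset.mem_filter.2 ⟨hv, h'⟩)
  have harcs : (D.arcs.card : ℝ) < d * D.verts.card + X.card := by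
    have := D.card_arcs_le A
    have : (D.arcs.card : ℝ) ≤
        ((∑ v ∈ D.verts \ A, D.outDeg v + ∑ v ∈ A, D.inDeg v : ℕ) : ℝ) + X.card := by
      exact_mod_cast this
    linarith
  refine ⟨A.card, (D.verts \ A).card, ?_, ?_, ?_, ?_⟩
  · rw [add_comm, Finset.card_sdiff_add_card_eq_card hsub]
  all_goals refine harcs.trans_le (by gcongr; exact_mod_cast ‹_›)

end FinDigraph

/-- Under the stated numerical conditions on `α, β, γ, δ`, every
`(r,β,γ)`-dense digraph `D` with maximum out- and in-degree at most `r` and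
`c(D) < αr` contains a vertex `v` with `min{d⁺(v), d⁻(v)} ≥ δr`. -/
theorem exists_vertex_high_out_and_in_degree {V : Type} [DecidableEq V]
    (r : ℕ) (hr : 1 ≤ r) (α β γ δ : ℝ) (hα : 0 < α) (hβ : 0 < β) (hγ : 0 < γ)
    (h1 : 2 * β < (1 - α / 2) ^ 2)
    (h2 : (1 - α / 2) - Real.sqrt ((1 - α / 2) ^ 2 - 2 * β) ≤ γ)
    (hδ0 : 0 < δ) (hδhalf : δ < 1 / 2) (hδβ : δ < 1 - Real.sqrt β)
    (h3 : 2 * ((1 - δ) - Real.sqrt ((1 - δ) ^ 2 - β)) ≤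
      (1 - α / 2) + Real.sqrt ((1 - α / 2) ^ 2 - 2 * β))
    (h4 : β / (1 / 2 - δ) ≤ 2 * ((1 - δ) + Real.sqrt ((1 - δ) ^ 2 - β)))
    (D : FinDigraph V) (hD : D.IsDense r β γ)
    (hout : ∀ v, D.outDeg v ≤ r) (hin : ∀ v, D.inDeg v ≤ r)
    (hc : (D.cNum : ℝ) < α * r) :
    ∃ v ∈ D.verts, δ * r ≤ (D.outDeg v : ℝ) ∧ δ * r ≤ (D.inDeg v : ℝ) := by
  by_contra! hcon
  have hr' : (0 : ℝ) < r := by exact_mod_cast hr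
  obtain ⟨hN, harcs⟩ := hD
  have hNpos : (0 : ℝ) < D.verts.card := lt_of_lt_of_le (by positivity) hN
  have hne : D.verts.Nonempty := Finset.card_pos.1 (by exact_mod_cast hNpos)
  obtain ⟨a, b, hab, hmul, ha, hb⟩ := D.exists_card_arcs_lt hne hout hin hcon
  have hab' : (a : ℝ) + b = D.verts.card := by exact_mod_cast hab
  have hdig : 2 * (D.arcs.card : ℝ) ≤ D.verts.card ^ 2 + D.verts.card * D.cNum := by
    exact_mod_cast D.two_mul_card_arcs_le_cNum
  obtain ⟨n, hn⟩ : ∃ n : ℝ, (D.verts.card : ℝ) = n * r := ⟨D.verts.card / r, by field_simp⟩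
  rw [hn] at hN harcs hNpos hmul ha hb hab' hdig
  have hnpos : 0 < n := pos_of_mul_pos_left hNpos hr'.le
  have hγn : γ ≤ n := le_of_mul_le_mul_right hN hr'
  have hr2 : (0 : ℝ) < r ^ 2 := by positivity
  have hdigon : n - β < n ^ 2 / 2 + α * n / 2 := by
    have := mul_lt_mul_of_pos_left hc hNpos
    refine lt_of_mul_lt_mul_right ?_ hr2.le
    linarith
  have hquad : n - β < δ * n + n ^ 2 / 4 := by
    refine lt_of_mul_lt_mul_right ?_ hr2.le
    have : 4 * ((a : ℝ) * b) ≤ (n * r) ^ 2 := by rw [← hab']; nlinarith [sq_nonneg ((a : ℝ) - b)]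
    linarith
  have hlin : n < β / (1 / 2 - δ) := by
    rw [lt_div_iff₀ (by linarith)]
    refine lt_of_mul_lt_mul_right ?_ hr2.le
    have : (r : ℝ) * a + r * b = r * (n * r) := by rw [← hab']; ring
    linarith
  have hs : 0 ≤ (1 - δ) ^ 2 - β := by
    nlinarith [Real.sq_sqrt hβ.le, Real.sqrt_nonneg β]
  have hs' := Real.sq_sqrt hs
  have ht' := Real.sq_sqrt (show 0 ≤ (1 - α / 2) ^ 2 - 2 * β by linarith)
  set s := Real.sqrt ((1 - δ) ^ 2 - β)
  set t := Real.sqrt ((1 - α / 2) ^ 2 - 2 * β)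
  have hlow : n < 2 * ((1 - δ) - s) := by
    by_contra! h
    nlinarith [mul_nonneg (sub_nonneg.2 h) (sub_nonneg.2 (hlin.le.trans h4))]
  nlinarith [mul_nonneg (sub_nonneg.2 (h2.trans hγn)) (sub_nonneg.2 (hlow.le.trans h3))]
end
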